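/- arXiv:1707.03442 — 3 statements merged into one kernel-verified Lean document; each statement's English description precedes it below -/
import Mathlib

section
/- Let U ⊆ ℝ² be an open neighborhood of the origin and let P, Q : U → ℝ be C² functions, so that λ = P dx + Q dy is a C² differential 1-form on U. Let C = {x = 0, y ≥ 0} ∪ {x = y², y ≥ 0} ∪ {y = 0, x ≥ 0} ∪ {y = x², x ≥ 0} be the union of four arcs emanating from the origin. Suppose λ vanishes on all tangent vectors to C, i.e. there is ε > 0 such that for all s ∈ [0, ε): P(s, 0) = 0, Q(0, s) = 0, P(s, s²) + 2s·Q(s, s²) = 0, and 2s·P(s², s) + Q(s², s) = 0. Then the exterior derivative of λ vanishes at the origin: ∂Q/∂x(0,0) − ∂P/∂y(0,0) = 0. -/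
open Filter Topology Asymptotics

/-- A strictly differentiable `f` vanishing on the positive `x`-axis satisfies
`f (s, s ^ 2) / s ^ 2 → ∂f/∂y(0,0)` as `s → 0⁺`. -/
theorem HasStrictFDerivAt.tendsto_parabola_div_sq {f : ℝ × ℝ → ℝ} {f' : ℝ × ℝ →L[ℝ] ℝ}
    (hf : HasStrictFDerivAt f f' (0, 0)) (h : ∀ᶠ s in 𝓝[>] (0 : ℝ), f (s, 0) = 0) :
    Tendsto (fun s : ℝ => f (s, s ^ 2) / s ^ 2) (𝓝[>] 0) (𝓝 (f' (0, 1))) := by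
  have hc : Tendsto (fun s : ℝ => (((s, s ^ 2), (s, 0)) : (ℝ × ℝ) × (ℝ × ℝ))) (𝓝[>] 0)
      (𝓝 ((0, 0), (0, 0))) := by
    have : Continuous fun s : ℝ => (((s, s ^ 2), (s, 0)) : (ℝ × ℝ) × (ℝ × ℝ)) := by fun_prop
    simpa using (this.tendsto 0).mono_left nhdsWithin_le_nhds
  have ho := hf.isLittleO.comp_tendsto hc
  have hO : ((fun p : (ℝ × ℝ) × (ℝ × ℝ) => p.1 - p.2) ∘
      fun s : ℝ => ((s, s ^ 2), (s, 0))) =O[𝓝[>] 0] fun s : ℝ => s ^ 2 :=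
    IsBigO.of_bound 1 (Eventually.of_forall fun s => by simp [Prod.norm_def, sq_nonneg])
  have ht := (ho.trans_isBigO hO).tendsto_div_nhds_zero.add_const (f' (0, 1))
  rw [zero_add] at ht
  refine ht.congr' ?_
  filter_upwards [h, self_mem_nhdsWithin] with s hs hpos
  have hs0 : s ≠ 0 := ne_of_gt hpos
  have hlin : f' (0, s ^ 2) = s ^ 2 * f' (0, 1) := by
    rw [← smul_eq_mul, ← map_smul]
    simp
  simp only [Function.comp_apply, Prod.mk_sub_mk, sub_self, sub_zero, hs, hlin]
  field_simp
  ring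

/-- If `f` is differentiable and vanishes at the origin, then
`f (s, s ^ 2) / s → ∂f/∂x(0,0)` as `s → 0⁺`. -/
theorem HasFDerivAt.tendsto_parabola_div {f : ℝ × ℝ → ℝ} {f' : ℝ × ℝ →L[ℝ] ℝ}
    (hf : HasFDerivAt f f' (0, 0)) (h : f (0, 0) = 0) :
    Tendsto (fun s : ℝ => f (s, s ^ 2) / s) (𝓝[>] 0) (𝓝 (f' (1, 0))) := by
  have hγ : HasDerivAt (fun s : ℝ => (s, s ^ 2)) ((1, 0) : ℝ × ℝ) 0 := by
    simpa using (hasDerivAt_id (0 : ℝ)).prodMk (hasDerivAt_pow 2 (0 : ℝ))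
  have hd : HasDerivAt (fun s : ℝ => f (s, s ^ 2)) (f' (1, 0)) 0 :=
    HasFDerivAt.comp_hasDerivAt (0 : ℝ) (by simpa using hf) hγ
  refine (hd.tendsto_slope.mono_left (nhdsWithin_mono _ fun s hs => ne_of_gt hs)).congr fun s => ?_
  simp [slope_def_field, h]

/-- If `P dx + Q dy` vanishes on the tangent vectors of `y = 0` and `y = x ^ 2` for `x ≥ 0`
small, and `Q` vanishes at the origin, then `∂P/∂y(0,0) + 2 ∂Q/∂x(0,0) = 0`. -/
theorem partial_add_two_mul_partial_eq_zero {P Q : ℝ × ℝ → ℝ} {P' Q' : ℝ × ℝ →L[ℝ] ℝ}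
    (hP : HasStrictFDerivAt P P' (0, 0)) (hQ : HasFDerivAt Q Q' (0, 0)) {ε : ℝ} (hε : 0 < ε)
    (haxis : ∀ s ∈ Set.Ico (0 : ℝ) ε, P (s, 0) = 0) (hQ0 : Q (0, 0) = 0)
    (hpar : ∀ s ∈ Set.Ico (0 : ℝ) ε, P (s, s ^ 2) + 2 * s * Q (s, s ^ 2) = 0) :
    P' (0, 1) + 2 * Q' (1, 0) = 0 := by
  have hmem : ∀ᶠ s in 𝓝[>] (0 : ℝ), s ∈ Set.Ioo 0 ε := Ioo_mem_nhdsGT hε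
  have hlim := (hP.tendsto_parabola_div_sq (hmem.mono fun s hs => haxis s ⟨hs.1.le, hs.2⟩)).add
    ((hQ.tendsto_parabola_div hQ0).const_mul 2)
  refine tendsto_nhds_unique (hlim.congr' ?_) tendsto_const_nhds
  filter_upwards [hmem] with s hs
  have hs0 : s ≠ 0 := hs.1.ne'
  field_simp
  linarith [hpar s ⟨hs.1.le, hs.2⟩]

/-- If a `C²` 1-form `λ = P dx + Q dy` on a neighborhood `U` of the origin in `ℝ²`
vanishes on the tangent vectors of the four arcs
`{x = 0, y ≥ 0} ∪ {x = y², y ≥ 0} ∪ {y = 0, x ≥ 0} ∪ {y = x², x ≥ 0}`,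
then its exterior derivative vanishes at the origin:
`∂Q/∂x(0,0) − ∂P/∂y(0,0) = 0`. -/
theorem stmt_0 (U : Set (ℝ × ℝ)) (hU : IsOpen U) (h0 : ((0 : ℝ), (0 : ℝ)) ∈ U)
    (P Q : ℝ × ℝ → ℝ) (hP : ContDiffOn ℝ 2 P U) (hQ : ContDiffOn ℝ 2 Q U)
    (ε : ℝ) (hε : 0 < ε)
    (harc1 : ∀ s ∈ Set.Ico (0 : ℝ) ε, P (s, 0) = 0)
    (harc2 : ∀ s ∈ Set.Ico (0 : ℝ) ε, Q (0, s) = 0)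
    (harc3 : ∀ s ∈ Set.Ico (0 : ℝ) ε, P (s, s ^ 2) + 2 * s * Q (s, s ^ 2) = 0)
    (harc4 : ∀ s ∈ Set.Ico (0 : ℝ) ε, 2 * s * P (s ^ 2, s) + Q (s ^ 2, s) = 0) :
    fderiv ℝ Q ((0 : ℝ), (0 : ℝ)) (1, 0) - fderiv ℝ P ((0 : ℝ), (0 : ℝ)) (0, 1) = 0 := by
  have hnhds := hU.mem_nhds h0
  have hP' := (hP.contDiffAt hnhds).hasStrictFDerivAt (by norm_num)
  have hQ' := (hQ.contDiffAt hnhds).hasStrictFDerivAt (by norm_num)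
  have hmem : (0 : ℝ) ∈ Set.Ico 0 ε := ⟨le_rfl, hε⟩
  have hswap : HasStrictFDerivAt (Prod.swap : ℝ × ℝ → ℝ × ℝ)
      (ContinuousLinearEquiv.prodComm ℝ ℝ ℝ : ℝ × ℝ →L[ℝ] ℝ × ℝ) (0, 0) :=
    (ContinuousLinearEquiv.prodComm ℝ ℝ ℝ).hasStrictFDerivAt
  have h₁ := partial_add_two_mul_partial_eq_zero hP' hQ'.hasFDerivAt hε harc1
    (harc2 0 hmem) harc3
  have hQswap : HasStrictFDerivAt (Q ∘ Prod.swap) _ (0, 0) :=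
    HasStrictFDerivAt.comp (g := Q) (f := Prod.swap) (0, 0) hQ' hswap
  have hPswap : HasStrictFDerivAt (P ∘ Prod.swap) _ (0, 0) :=
    HasStrictFDerivAt.comp (g := P) (f := Prod.swap) (0, 0) hP' hswap
  have h₂ := partial_add_two_mul_partial_eq_zero hQswap hPswap.hasFDerivAt hε harc2 (harc1 0 hmem)
    fun s hs => by simpa [add_comm] using harc4 s hs
  simp only [ContinuousLinearMap.comp_apply, ContinuousLinearEquiv.coe_coe,
    ContinuousLinearEquiv.prodComm_apply, Prod.swap_prod_mk] at h₂
  linarith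
end

section
/- Let d ≥ 1, let V : ℝ^d → ℝ^d be a C¹ vector field, and suppose V admits a complete flow φ : ℝ × ℝ^d → ℝ^d, i.e. φ(0, x) = x and ∂φ/∂t(t,x) = V(φ(t,x)) for all t, x. Let X ⊆ ℝ^d be compact and let c > 0 be such that the divergence of V satisfies div V(x) = trace(DV(x)) ≥ c for all x ∈ X. Then the set Core := { x ∈ X : φ(t, x) ∈ X for all t ≥ 0 } has d-dimensional Lebesgue measure zero. -/
open MeasureTheory

open Set Filter Topology Module

/-- The derivative of the determinant at the identity matrix is the trace. -/
lemma Matrix.hasFDerivAt_det_one_add {n : Type*} [Fintype n] [DecidableEq n] :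
    ∃ f' : (n → n → ℝ) →L[ℝ] ℝ,
      HasFDerivAt (fun M : n → n → ℝ => (1 + Matrix.of M).det) f' 0 ∧
        ∀ M, f' M = (Matrix.of M).trace := by
  have hdiff : Differentiable ℝ (fun M : n → n → ℝ => (1 + Matrix.of M).det) := by
    simp only [Matrix.det_apply, Matrix.add_apply, Matrix.of_apply]
    fun_prop
  refine ⟨_, (hdiff 0).hasFDerivAt, fun M => ?_⟩
  have hline : HasDerivAt (fun t : ℝ => t • M) M 0 := by
    simpa using (hasDerivAt_id (0 : ℝ)).smul_const M
  have hchain := HasFDerivAt.comp_hasDerivAt (0 : ℝ)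
    (l := fun M : n → n → ℝ => (1 + Matrix.of M).det)
    (hdiff _).hasFDerivAt hline
  rw [zero_smul] at hchain
  refine hchain.unique ?_
  set q := (1 + (Polynomial.X : Polynomial ℝ) • (Matrix.of M).map Polynomial.C).det.divX.divX
  have hpoly : HasDerivAt (fun t : ℝ => 1 + (Matrix.of M).trace * t + q.eval t * t ^ 2)
      (Matrix.of M).trace 0 := by
    have h := (((hasDerivAt_id (0 : ℝ)).const_mul (Matrix.of M).trace).const_add 1).add
      ((q.hasDerivAt 0).mul ((hasDerivAt_id (0 : ℝ)).pow 2))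
    simpa using! h
  refine hpoly.congr_of_eventuallyEq (Eventually.of_forall fun t => ?_)
  exact Matrix.det_one_add_smul t (Matrix.of M)

/-- The derivative of the determinant at the identity operator is the trace. -/
lemma ContinuousLinearMap.hasFDerivAt_det_one_add {E : Type*} [NormedAddCommGroup E]
    [NormedSpace ℝ E] [FiniteDimensional ℝ E] :
    ∃ f' : (E →L[ℝ] E) →L[ℝ] ℝ,
      HasFDerivAt (fun A : E →L[ℝ] E => (1 + A).det) f' 0 ∧
        ∀ A : E →L[ℝ] E, f' A = LinearMap.trace ℝ E (A : E →ₗ[ℝ] E) := by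
  classical
  let b := finBasis ℝ E
  let T : (E →L[ℝ] E) →ₗ[ℝ] (Fin (finrank ℝ E) → Fin (finrank ℝ E) → ℝ) :=
    { toFun := fun A i j => LinearMap.toMatrix b b (A : E →ₗ[ℝ] E) i j
      map_add' := fun A B => by ext; simp
      map_smul' := fun r A => by ext; simp }
  have hT (A : E →L[ℝ] E) : Matrix.of (T A) = LinearMap.toMatrix b b (A : E →ₗ[ℝ] E) := rfl
  obtain ⟨g', hg', hg'_apply⟩ := Matrix.hasFDerivAt_det_one_add (n := Fin (finrank ℝ E))
  have hT' := (LinearMap.toContinuousLinearMap T).hasFDerivAt (x := 0)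
  refine ⟨g'.comp (LinearMap.toContinuousLinearMap T), ?_, fun A => ?_⟩
  · have h := HasFDerivAt.comp (0 : E →L[ℝ] E)
      (g := fun M : Fin (finrank ℝ E) → Fin (finrank ℝ E) → ℝ => (1 + Matrix.of M).det)
      (by simpa using hg') hT'
    refine h.congr_of_eventuallyEq (Eventually.of_forall fun A => ?_)
    simp only [Function.comp_apply, LinearMap.coe_toContinuousLinearMap', hT]
    rw [ContinuousLinearMap.det, ← LinearMap.det_toMatrix b]
    simp [LinearMap.toMatrix_one]
  · simp only [ContinuousLinearMap.comp_apply, LinearMap.coe_toContinuousLinearMap', hg'_apply, hT]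
    rw [LinearMap.trace_eq_matrix_trace ℝ b]

lemma eventually_nhdsGT_zero_const_mul_lt (k : ℝ) {ε : ℝ} (hε : 0 < ε) :
    ∀ᶠ t : ℝ in 𝓝[>] 0, k * t < ε :=
  (Continuous.tendsto' (by fun_prop) 0 0 (by simp)).mono_left nhdsWithin_le_nhds
    |>.eventually_lt_const hε

/-- If `A` has trace at least `c`, then `det (1 + t A) ≥ 1 + t c / 2` for all small `t > 0`,
uniformly in `A` of bounded norm. -/
lemma eventually_le_det_one_add_smul {E : Type*} [NormedAddCommGroup E]
    [NormedSpace ℝ E] [FiniteDimensional ℝ E] {c L : ℝ} (hc : 0 < c) (hL : 0 ≤ L) :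
    ∀ᶠ t : ℝ in 𝓝[>] 0, ∀ A : E →L[ℝ] E, ‖A‖ ≤ L →
      c ≤ LinearMap.trace ℝ E (A : E →ₗ[ℝ] E) → 1 + t * (c / 2) ≤ (1 + t • A).det := by
  obtain ⟨f', hf', hf'_apply⟩ := ContinuousLinearMap.hasFDerivAt_det_one_add (E := E)
  have hη : 0 < c / (2 * (L + 1)) := by positivity
  obtain ⟨δ, hδ, hδ'⟩ := Metric.eventually_nhds_iff.1 (hf'.isLittleO.def hη)
  filter_upwards [eventually_nhdsGT_zero_const_mul_lt (L + 1) hδ, self_mem_nhdsWithin]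
    with t ht ht0 A hA hcA
  rw [mem_Ioi] at ht0
  have hnorm : ‖t • A‖ ≤ t * L := by
    rw [norm_smul, Real.norm_of_nonneg ht0.le]
    gcongr
  have h := hδ' (y := t • A) (by rw [dist_zero_right]; nlinarith)
  rw [add_zero, sub_zero, map_smul, hf'_apply, smul_eq_mul] at h
  have hdet1 : (1 : E →L[ℝ] E).det = 1 := by
    simp [ContinuousLinearMap.det]
  rw [hdet1, Real.norm_eq_abs] at h
  have h1 := (abs_le.1 h).1
  have h2 : c / (2 * (L + 1)) * ‖t • A‖ ≤ t * (c / 2) := by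
    calc c / (2 * (L + 1)) * ‖t • A‖ ≤ c / (2 * (L + 1)) * (t * (L + 1)) := by
          gcongr
          nlinarith
      _ = t * (c / 2) := by field_simp
  nlinarith [mul_le_mul_of_nonneg_left hcA ht0.le]

/-- If `F` expands distances on `s` at most `C` times as much as `g` does, then
`F '' s` has volume at most `C ^ d` times that of `g '' s`. -/
lemma EuclideanSpace.volume_image_le_of_dist_le {d : ℕ} {α : Type*} {s : Set α} {C : NNReal}
    {F g : α → EuclideanSpace ℝ (Fin d)}
    (h : ∀ x ∈ s, ∀ y ∈ s, dist (F x) (F y) ≤ C * dist (g x) (g y)) :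
    volume (F '' s) ≤ (C : ENNReal) ^ d * volume (g '' s) := by
  rcases s.eq_empty_or_nonempty with rfl | ⟨x₀, hx₀⟩
  · simp
  have : Nonempty α := ⟨x₀⟩
  have hinv : ∀ x ∈ s, Function.invFunOn g s (g x) ∈ s ∧ g (Function.invFunOn g s (g x)) = g x :=
    fun x hx => ⟨Function.invFunOn_mem ⟨x, hx, rfl⟩, Function.invFunOn_eq ⟨x, hx, rfl⟩⟩
  have hFinv : ∀ x ∈ s, F (Function.invFunOn g s (g x)) = F x := fun x hx => by
    have := h _ (hinv x hx).1 x hx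
    rw [(hinv x hx).2, dist_self, mul_zero] at this
    exact dist_le_zero.1 this
  have hLip : LipschitzOnWith C (F ∘ Function.invFunOn g s) (g '' s) := by
    refine LipschitzOnWith.of_dist_le_mul ?_
    rintro _ ⟨x, hx, rfl⟩ _ ⟨y, hy, rfl⟩
    simp only [Function.comp_apply, hFinv x hx, hFinv y hy]
    exact h x hx y hy
  have himage : (F ∘ Function.invFunOn g s) '' (g '' s) = F '' s := by
    rw [image_image]
    exact image_congr fun x hx => hFinv x hx
  have hH := hLip.hausdorffMeasure_image_le (d := d) (by positivity)
  rw [himage, ENNReal.rpow_natCast] at hH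
  rw [← EuclideanSpace.euclideanHausdorffMeasure_eq_volume, Measure.euclideanHausdorffMeasure_def,
    Measure.smul_apply, Measure.smul_apply, ENNReal.smul_def, ENNReal.smul_def, smul_eq_mul,
    smul_eq_mul, mul_left_comm]
  gcongr

section
variable {E : Type*} [NormedAddCommGroup E] [NormedSpace ℝ E]

/-- A second-difference version of the mean value inequality on a convex set. -/
lemma Convex.norm_sub_sub_sub_le {V : E → E} {B : Set E} (hB : Convex ℝ B)
    (hV : Differentiable ℝ V) {L ω δ : ℝ} (hL : ∀ z ∈ B, ‖fderiv ℝ V z‖ ≤ L)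
    (hω : ∀ z ∈ B, ∀ w ∈ B, ‖z - w‖ ≤ δ → ‖fderiv ℝ V z - fderiv ℝ V w‖ ≤ ω)
    {x y x' y' : E} (hx : x ∈ B) (hy : y ∈ B) (hx' : x' ∈ B) (hy' : y' ∈ B)
    (hxx' : ‖x' - x‖ ≤ δ) (hyy' : ‖y' - y‖ ≤ δ) :
    ‖V x' - V y' - (V x - V y)‖ ≤ ω * ‖x - y‖ + L * ‖x' - y' - (x - y)‖ := by
  set p : ℝ →ᵃ[ℝ] E := AffineMap.lineMap y x
  set q : ℝ →ᵃ[ℝ] E := AffineMap.lineMap y' x'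
  have hderiv : ∀ θ ∈ Icc (0 : ℝ) 1, HasDerivWithinAt (fun θ => V (q θ) - V (p θ))
      (fderiv ℝ V (q θ) (x' - y') - fderiv ℝ V (p θ) (x - y)) (Icc 0 1) θ := fun θ _ =>
    (((hV (q θ)).hasFDerivAt.comp_hasDerivAt θ AffineMap.hasDerivAt_lineMap).sub
      ((hV (p θ)).hasFDerivAt.comp_hasDerivAt θ AffineMap.hasDerivAt_lineMap)).hasDerivWithinAt
  have hbound : ∀ θ ∈ Ico (0 : ℝ) 1,
      ‖fderiv ℝ V (q θ) (x' - y') - fderiv ℝ V (p θ) (x - y)‖ ≤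
        ω * ‖x - y‖ + L * ‖x' - y' - (x - y)‖ := by
    intro θ hθ
    have hθ' := Ico_subset_Icc_self hθ
    have hp : p θ ∈ B := hB.mapsTo_lineMap hy hx hθ'
    have hq : q θ ∈ B := hB.mapsTo_lineMap hy' hx' hθ'
    have hpq : ‖q θ - p θ‖ ≤ δ := by
      have heq : q θ - p θ = (1 - θ) • (y' - y) + θ • (x' - x) := by
        simp only [p, q, AffineMap.lineMap_apply_module]
        module
      rw [heq]
      refine (norm_add_le _ _).trans ?_
      rw [norm_smul, norm_smul, Real.norm_of_nonneg hθ.1, Real.norm_of_nonneg (by linarith [hθ.2])]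
      nlinarith [mul_le_mul_of_nonneg_left hxx' hθ.1,
        mul_le_mul_of_nonneg_left hyy' (sub_nonneg.2 hθ.2.le)]
    have heq : fderiv ℝ V (q θ) (x' - y') - fderiv ℝ V (p θ) (x - y) =
        (fderiv ℝ V (q θ) - fderiv ℝ V (p θ)) (x - y) +
          fderiv ℝ V (q θ) (x' - y' - (x - y)) := by
      simp only [sub_apply, map_sub]
      abel
    rw [heq]
    refine (norm_add_le _ _).trans (add_le_add ?_ ?_)
    · exact ContinuousLinearMap.le_of_opNorm_le _ (hω _ hq _ hp hpq) _
    · exact ContinuousLinearMap.le_of_opNorm_le _ (hL _ hq) _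
  have h := norm_image_sub_le_of_norm_deriv_le_segment_01' hderiv hbound
  simp only [p, q, AffineMap.lineMap_apply_one, AffineMap.lineMap_apply_zero] at h
  convert h using 2
  abel

/-- Two integral curves in a set where the vector field is Lipschitz diverge at most
exponentially. -/
lemma dist_integralCurve_le {V : E → E} {B : Set E} {L : NNReal} (hV : LipschitzOnWith L V B)
    {T : ℝ} {α β : ℝ → E} (hα : ∀ s, HasDerivAt α (V (α s)) s)
    (hβ : ∀ s, HasDerivAt β (V (β s)) s) (hαB : ∀ s ∈ Icc 0 T, α s ∈ B)
    (hβB : ∀ s ∈ Icc 0 T, β s ∈ B) :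
    ∀ s ∈ Icc 0 T, dist (α s) (β s) ≤ dist (α 0) (β 0) * Real.exp (L * s) := by
  intro s hs
  simpa using dist_le_of_trajectories_ODE_of_mem (v := fun _ => V) (s := fun _ => B)
    (fun _ _ => hV) (fun s _ => (hα s).continuousAt.continuousWithinAt)
    (fun s _ => (hα s).hasDerivWithinAt) (fun s hs => hαB s (Ico_subset_Icc_self hs))
    (fun s _ => (hβ s).continuousAt.continuousWithinAt)
    (fun s _ => (hβ s).hasDerivWithinAt) (fun s hs => hβB s (Ico_subset_Icc_self hs))
    le_rfl s hs

/-- A `C¹` map is Lipschitz on compact convex sets. -/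
lemma ContDiff.exists_norm_fderiv_le_and_lipschitzOnWith {V : E → E} (hV : ContDiff ℝ 1 V)
    {B : Set E} (hB : IsCompact B) (hBc : Convex ℝ B) :
    ∃ L : NNReal, (∀ z ∈ B, ‖fderiv ℝ V z‖ ≤ L) ∧ LipschitzOnWith L V B := by
  obtain ⟨L, hL⟩ := hB.exists_bound_of_continuousOn
    (hV.continuous_fderiv one_ne_zero).continuousOn
  have hbound : ∀ z ∈ B, ‖fderiv ℝ V z‖ ≤ L.toNNReal :=
    fun z hz => (hL z hz).trans (Real.le_coe_toNNReal L)
  exact ⟨_, hbound, hBc.lipschitzOnWith_of_nnnorm_fderiv_le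
    (fun z _ => hV.differentiable one_ne_zero z) hbound⟩

/-- For small times, one step of the Euler method is at most `1 + ε t` times as expanding as the
flow, uniformly for integral curves staying in a compact convex set. -/
lemma eventually_dist_euler_le {V : E → E} (hV : ContDiff ℝ 1 V) {B : Set E} (hB : IsCompact B)
    (hBc : Convex ℝ B) {ε : ℝ} (hε : 0 < ε) :
    ∀ᶠ t : ℝ in 𝓝[>] 0, ∀ α β : ℝ → E, (∀ s, HasDerivAt α (V (α s)) s) →
      (∀ s, HasDerivAt β (V (β s)) s) → (∀ s ∈ Icc 0 t, α s ∈ B) → (∀ s ∈ Icc 0 t, β s ∈ B) →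
      dist (α 0 + t • V (α 0)) (β 0 + t • V (β 0)) ≤ (1 + ε * t) * dist (α t) (β t) := by
  have hdiff : Differentiable ℝ V := hV.differentiable one_ne_zero
  have hcont : Continuous (fderiv ℝ V) := hV.continuous_fderiv one_ne_zero
  obtain ⟨M, hM⟩ := hB.exists_bound_of_continuousOn hV.continuous.continuousOn
  obtain ⟨L, hL, hLip⟩ := hV.exists_norm_fderiv_le_and_lipschitzOnWith hB hBc
  obtain ⟨δ, hδ, hδ'⟩ := Metric.uniformContinuousOn_iff_le.1
    (hB.uniformContinuousOn_of_continuous hcont.continuousOn) (ε / 4) (by positivity)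
  have hω : ∀ z ∈ B, ∀ w ∈ B, ‖z - w‖ ≤ δ → ‖fderiv ℝ V z - fderiv ℝ V w‖ ≤ ε / 4 :=
    fun z hz w hw h => by
      simpa [dist_eq_norm] using hδ' z hz w hw (by simpa [dist_eq_norm] using h)
  filter_upwards [self_mem_nhdsWithin, eventually_nhdsGT_zero_const_mul_lt 1 one_pos,
    eventually_nhdsGT_zero_const_mul_lt M hδ,
    eventually_nhdsGT_zero_const_mul_lt (L * (L * Real.exp L)) (show 0 < ε / 4 by positivity),
    eventually_nhdsGT_zero_const_mul_lt (L * Real.exp L) one_half_pos]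
    with t ht0 ht1 htM htL htL' α β hα hβ hαB hβB
  rw [mem_Ioi] at ht0
  rw [one_mul] at ht1
  have h0 : (0 : ℝ) ∈ Icc 0 t := ⟨le_rfl, ht0.le⟩
  have hmove : ∀ γ : ℝ → E, (∀ s, HasDerivAt γ (V (γ s)) s) → (∀ s ∈ Icc 0 t, γ s ∈ B) →
      ∀ s ∈ Icc 0 t, ‖γ s - γ 0‖ ≤ δ := by
    intro γ hγ hγB s hs
    have hM0 : 0 ≤ M := (norm_nonneg _).trans (hM _ (hγB 0 h0))
    have h := norm_image_sub_le_of_norm_deriv_le_segment'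
      (fun s _ => (hγ s).hasDerivWithinAt) (fun s hs => hM _ (hγB s (Ico_subset_Icc_self hs))) s hs
    nlinarith [hs.2]
  set D := dist (α 0) (β 0)
  have hD : D = ‖α 0 - β 0‖ := dist_eq_norm _ _
  have hD0 : 0 ≤ D := dist_nonneg
  have hgrow : ∀ s ∈ Icc 0 t, dist (α s) (β s) ≤ D * Real.exp L := fun s hs => by
    refine (dist_integralCurve_le hLip hα hβ hαB hβB s hs).trans ?_
    gcongr
    exact mul_le_of_le_one_right L.2 (hs.2.trans ht1.le)
  have hdrift : ∀ s ∈ Icc 0 t, ‖α s - β s - (α 0 - β 0)‖ ≤ L * Real.exp L * t * D := by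
    intro s hs
    have h := norm_image_sub_le_of_norm_deriv_le_segment'
      (f := fun s => α s - β s) (C := L * (D * Real.exp L))
      (fun s _ => ((hα s).sub (hβ s)).hasDerivWithinAt) (fun s hs => by
        have hs' := Ico_subset_Icc_self hs
        rw [← dist_eq_norm]
        exact (hLip.dist_le_mul _ (hαB s hs') _ (hβB s hs')).trans
          (mul_le_mul_of_nonneg_left (hgrow s hs') L.2)) s hs
    refine h.trans ?_
    have : L * (D * Real.exp L) * (s - 0) ≤ L * (D * Real.exp L) * t := by
      gcongr
      linarith [hs.2]
    linarith
  have herr : ‖α t - β t - (α 0 - β 0) - t • (V (α 0) - V (β 0))‖ ≤ ε / 2 * D * t := by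
    have h := norm_image_sub_le_of_norm_deriv_le_segment'
      (f := fun s => α s - β s - s • (V (α 0) - V (β 0))) (C := ε / 2 * D) (a := 0) (b := t)
      (fun s _ => (((hα s).sub (hβ s)).sub
        ((hasDerivAt_id s).smul_const (V (α 0) - V (β 0)))).hasDerivWithinAt) (fun s hs => by
        have hs' := Ico_subset_Icc_self hs
        have h2 := hBc.norm_sub_sub_sub_le hdiff hL hω (hαB 0 h0) (hβB 0 h0) (hαB s hs')
          (hβB s hs') (hmove α hα hαB s hs') (hmove β hβ hβB s hs')
        rw [← hD] at h2
        rw [one_smul]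
        have h3 := mul_le_mul_of_nonneg_left (hdrift s hs') L.2
        have h4 := mul_le_mul_of_nonneg_right htL.le hD0
        simp only [NNReal.val_eq_coe] at h3
        linarith) t ⟨ht0.le, le_rfl⟩
    simp only [zero_smul, sub_zero] at h
    convert h using 2
    abel
  have hlower : D ≤ 2 * dist (α t) (β t) := by
    have h1 := hdrift t ⟨ht0.le, le_rfl⟩
    have h2 := norm_sub_norm_le (α 0 - β 0) (α t - β t)
    rw [norm_sub_rev (α 0 - β 0) (α t - β t)] at h2
    rw [dist_eq_norm (α t)]
    rw [← hD] at h2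
    nlinarith
  have htri : dist (α 0 + t • V (α 0)) (β 0 + t • V (β 0)) ≤
      dist (α t) (β t) + ε / 2 * D * t := by
    rw [dist_eq_norm, dist_eq_norm]
    have heq : α 0 + t • V (α 0) - (β 0 + t • V (β 0)) =
        α t - β t - (α t - β t - (α 0 - β 0) - t • (V (α 0) - V (β 0))) := by
      module
    rw [heq]
    exact (norm_sub_le _ _).trans (by gcongr)
  have h5 := mul_le_mul_of_nonneg_left hlower (by positivity : 0 ≤ ε / 2 * t)
  linarith

/-- Integral curves of a `C¹` vector field with the same initial value agree for positive times. -/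
lemma integralCurve_eq_of_eq_zero [ProperSpace E] {V : E → E} (hV : ContDiff ℝ 1 V)
    {α β : ℝ → E} (hα : ∀ s, HasDerivAt α (V (α s)) s)
    (hβ : ∀ s, HasDerivAt β (V (β s)) s) (h0 : α 0 = β 0) {t : ℝ} (ht : 0 ≤ t) : α t = β t := by
  have hcα : Continuous α := continuous_iff_continuousAt.2 fun s => (hα s).continuousAt
  have hcβ : Continuous β := continuous_iff_continuousAt.2 fun s => (hβ s).continuousAt
  obtain ⟨R, hR⟩ := ((isCompact_Icc.image hcα).union
    (isCompact_Icc.image hcβ)).isBounded.subset_closedBall 0 (s := α '' Icc 0 t ∪ β '' Icc 0 t)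
  obtain ⟨L, -, hL⟩ := hV.exists_norm_fderiv_le_and_lipschitzOnWith
    (isCompact_closedBall 0 R) (convex_closedBall 0 R)
  have h := dist_integralCurve_le hL hα hβ (fun s hs => hR (Or.inl (mem_image_of_mem α hs)))
    (fun s hs => hR (Or.inr (mem_image_of_mem β hs))) t ⟨ht, le_rfl⟩
  rw [h0, dist_self, zero_mul] at h
  exact dist_le_zero.1 h

/-- The set of points whose forward orbit stays in a compact set is closed. -/
lemma isClosed_forwardTrapped [ProperSpace E] {V : E → E} (hV : ContDiff ℝ 1 V)
    {φ : ℝ → E → E} (hφ0 : ∀ x, φ 0 x = x)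
    (hφ : ∀ t x, HasDerivAt (fun s => φ s x) (V (φ t x)) t) {X : Set E} (hX : IsCompact X) :
    IsClosed {x | ∀ t : ℝ, 0 ≤ t → φ t x ∈ X} := by
  refine isClosed_of_closure_subset fun x hx t ht => ?_
  have hc : Continuous fun s => φ s x :=
    continuous_iff_continuousAt.2 fun s => (hφ s x).continuousAt
  obtain ⟨R, hR⟩ := (hX.union (isCompact_Icc.image hc)).isBounded.subset_closedBall 0
    (s := X ∪ (fun s => φ s x) '' Icc 0 t)
  obtain ⟨L, -, hL⟩ := hV.exists_norm_fderiv_le_and_lipschitzOnWith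
    (isCompact_closedBall 0 R) (convex_closedBall 0 R)
  rw [← hX.isClosed.closure_eq, Metric.mem_closure_iff]
  intro ε hε
  obtain ⟨y, hy, hxy⟩ := Metric.mem_closure_iff.1 hx (ε / Real.exp (L * t)) (by positivity)
  refine ⟨φ t y, hy t ht, ?_⟩
  have h := dist_integralCurve_le hL (fun s => hφ s x) (fun s => hφ s y)
    (fun s hs => hR (Or.inr (mem_image_of_mem _ hs)))
    (fun s hs => hR (Or.inl (hy s hs.1))) t ⟨ht, le_rfl⟩
  simp only [hφ0] at h
  exact h.trans_lt ((lt_div_iff₀ (Real.exp_pos _)).1 hxy)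

/-- Short Euler steps of a Lipschitz vector field are injective. -/
lemma LipschitzOnWith.injOn_add_smul {V : E → E} {B : Set E} {L : NNReal}
    (hV : LipschitzOnWith L V B) {t : ℝ} (ht : 0 ≤ t) (htL : L * t < 1) :
    InjOn (fun x => x + t • V x) B := by
  intro x hx y hy hxy
  have heq : x - y = t • (V y - V x) := by
    have : x - y = (x + t • V x) - (y + t • V y) + t • (V y - V x) := by module
    rw [this, show x + t • V x = y + t • V y from hxy, sub_self, zero_add]
  have h := hV.dist_le_mul y hy x hx
  have h' : dist x y = t * dist (V y) (V x) := by
    rw [dist_eq_norm, heq, norm_smul, Real.norm_of_nonneg ht, dist_eq_norm]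
  rw [dist_comm y x] at h
  have : dist x y ≤ 0 := by
    by_contra! hpos
    nlinarith [mul_le_mul_of_nonneg_left h ht]
  exact dist_le_zero.1 this
end

/-- One Euler step for a vector field of divergence at least `c` on `K` expands the volume of `K`
by a factor of at least `1 + t c / 2`, for small `t > 0`. -/
lemma eventually_mul_volume_le_volume_image_euler {E : Type*} [NormedAddCommGroup E]
    [NormedSpace ℝ E] [FiniteDimensional ℝ E] [MeasurableSpace E] [BorelSpace E]
    (μ : Measure E) [μ.IsAddHaarMeasure] {V : E → E} (hV : ContDiff ℝ 1 V)
    {K : Set E} (hK : IsCompact K) {c : ℝ} (hc : 0 < c)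
    (hdiv : ∀ x ∈ K, c ≤ LinearMap.trace ℝ E (fderiv ℝ V x : E →ₗ[ℝ] E)) :
    ∀ᶠ t : ℝ in 𝓝[>] 0,
      ENNReal.ofReal (1 + t * (c / 2)) * μ K ≤ μ ((fun x => x + t • V x) '' K) := by
  obtain ⟨R, hR⟩ := hK.isBounded.subset_closedBall 0
  obtain ⟨L, hL, hLip⟩ := hV.exists_norm_fderiv_le_and_lipschitzOnWith
    (isCompact_closedBall 0 R) (convex_closedBall 0 R)
  filter_upwards [self_mem_nhdsWithin, eventually_le_det_one_add_smul (E := E) hc L.2,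
    eventually_nhdsGT_zero_const_mul_lt L one_pos] with t ht0 hdet htL
  rw [mem_Ioi] at ht0
  have hderiv : ∀ x ∈ K, HasFDerivWithinAt (fun x => x + t • V x)
      (1 + t • fderiv ℝ V x) K x := fun x _ =>
    ((hasFDerivAt_id x).add
      ((hV.differentiable one_ne_zero x).hasFDerivAt.const_smul t)).hasFDerivWithinAt
  refine le_trans ?_ (lintegral_abs_det_fderiv_le_addHaar_image μ hK.measurableSet hderiv
    ((hLip.injOn_add_smul ht0.le htL).mono hR))
  rw [← setLIntegral_const]
  refine setLIntegral_mono' hK.measurableSet fun x hx => ENNReal.ofReal_le_ofReal ?_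
  exact (hdet _ (hL x (hR hx)) (hdiv x hx)).trans (le_abs_self _)

lemma one_add_pow_lt_one_add_two_mul {d : ℕ} {v u : ℝ} (hu : 0 < u) (hu' : u < 1 / 2)
    (hv : 0 ≤ v) (hdv : d * v ≤ u) : (1 + v) ^ d < 1 + 2 * u := by
  have h1 : (1 + v) ^ d ≤ Real.exp u := by
    calc (1 + v) ^ d ≤ Real.exp v ^ d := by
          gcongr
          linarith [Real.add_one_le_exp v]
      _ = Real.exp (d * v) := (Real.exp_nat_mul v d).symm
      _ ≤ Real.exp u := Real.exp_le_exp.2 hdv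
  refine h1.trans_lt ?_
  have h2 := Real.add_one_le_exp (-u)
  have h3 : Real.exp u * Real.exp (-u) = 1 := by rw [← Real.exp_add]; simp
  have h4 := Real.exp_pos u
  nlinarith [mul_le_mul_of_nonneg_left h2 h4.le]

/-- If a `C¹` vector field `V` on `ℝ^d` with complete flow `φ` has divergence
`div V = trace (DV) ≥ c > 0` on a compact set `X`, then the forward-trapped set
`{x ∈ X : φ_t(x) ∈ X for all t ≥ 0}` has Lebesgue measure zero. -/
theorem stmt_6 (d : ℕ) (hd : 1 ≤ d)
    (V : EuclideanSpace ℝ (Fin d) → EuclideanSpace ℝ (Fin d))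
    (hV : ContDiff ℝ 1 V)
    (φ : ℝ → EuclideanSpace ℝ (Fin d) → EuclideanSpace ℝ (Fin d))
    (hφ0 : ∀ x, φ 0 x = x)
    (hφ : ∀ (t : ℝ) (x : EuclideanSpace ℝ (Fin d)),
      HasDerivAt (fun s => φ s x) (V (φ t x)) t)
    (X : Set (EuclideanSpace ℝ (Fin d))) (hX : IsCompact X)
    (c : ℝ) (hc : 0 < c)
    (hdiv : ∀ x ∈ X, c ≤ LinearMap.trace ℝ (EuclideanSpace ℝ (Fin d))
      (fderiv ℝ V x : EuclideanSpace ℝ (Fin d) →ₗ[ℝ] EuclideanSpace ℝ (Fin d))) :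
    volume {x | x ∈ X ∧ ∀ t : ℝ, 0 ≤ t → φ t x ∈ X} = 0 := by
  set K := {x | x ∈ X ∧ ∀ t : ℝ, 0 ≤ t → φ t x ∈ X}
  have hKc : IsCompact K := hX.inter_right (isClosed_forwardTrapped hV hφ0 hφ hX)
  have hinv : ∀ t : ℝ, 0 ≤ t → φ t '' K ⊆ K := by
    rintro t ht _ ⟨x, hx, rfl⟩
    refine ⟨hx.2 t ht, fun s hs => ?_⟩
    have hshift : φ s (φ t x) = φ (s + t) x :=
      integralCurve_eq_of_eq_zero hV (α := fun s => φ s (φ t x)) (β := fun s => φ (s + t) x)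
        (fun s => hφ s _) (fun s => (hφ (s + t) x).comp_add_const s t) (by simp [hφ0]) hs
    rw [hshift]
    exact hx.2 _ (add_nonneg hs ht)
  obtain ⟨R, hR⟩ := hX.isBounded.subset_closedBall 0
  have hd' : (0 : ℝ) < d := by exact_mod_cast hd
  obtain ⟨t, ht0, htc, hexpand, hcompare⟩ := (eventually_mem_nhdsWithin.and
    ((eventually_nhdsGT_zero_const_mul_lt (c / 4) one_half_pos).and
      ((eventually_mul_volume_le_volume_image_euler volume hV hKc hc fun x hx => hdiv x hx.1).and
        (eventually_dist_euler_le hV (isCompact_closedBall 0 R) (convex_closedBall 0 R)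
          (show 0 < c / (4 * d) by positivity))))).exists
  rw [mem_Ioi] at ht0
  obtain ⟨C, hC⟩ : ∃ C : NNReal, (C : ℝ) = 1 + c / (4 * d) * t :=
    ⟨⟨_, by positivity⟩, rfl⟩
  have hshrink := EuclideanSpace.volume_image_le_of_dist_le (s := K)
    (C := C) (F := fun x => x + t • V x) (g := φ t)
    fun x hx y hy => by
      simpa [hφ0, hC] using hcompare (fun s => φ s x) (fun s => φ s y) (fun s => hφ s x)
        (fun s => hφ s y) (fun s hs => hR (hx.2 s hs.1)) (fun s hs => hR (hy.2 s hs.1))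
  have hle := (hexpand.trans hshrink).trans
    (mul_le_mul_right (measure_mono (hinv t ht0.le)) _)
  by_contra hne
  have hle' := (ENNReal.mul_le_mul_iff_left hne hKc.measure_lt_top.ne).1 hle
  rw [← ENNReal.coe_pow, ENNReal.ofReal, ENNReal.coe_le_coe, ← NNReal.coe_le_coe,
    Real.coe_toNNReal _ (by positivity), NNReal.coe_pow, hC] at hle'
  have hlt := one_add_pow_lt_one_add_two_mul (d := d) (v := c / (4 * d) * t) (u := c / 4 * t)
    (by positivity) htc (by positivity) (le_of_eq (by field_simp))
  linarith
end

section
/- Let n ≥ 1 and consider ℝ^{2n+1} = ℝ^n × ℝ^n × ℝ with coordinates (x, y, z) and the standard contact 1-form α given at every point by α(x,y,z)(u, v, w) = w + Σ_{i=1}^n (x_i·v_i − y_i·u_i) (i.e. α = dz + Σ(x_i dy_i − y_i dx_i)). For s ∈ ℝ let ψ_s(x, y, z) = (e^s x, e^s y, e^{2s} z), the flow of the contact vector field W = 2z ∂/∂z + Σ (x_i ∂/∂x_i + y_i ∂/∂y_i). Let U ⊆ ℝ^{2n+1} be an open set which contains the origin and is star-shaped with respect to W, i.e. ψ_{-s}(U)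 ⊆ U for every s ≥ 0. Then U is contactomorphic to the standard contact ℝ^{2n+1}: there exist a smooth diffeomorphism F : U → ℝ^{2n+1} (a smooth bijection onto ℝ^{2n+1} with smooth inverse) and a smooth function g : U → ℝ with g > 0 everywhere, such that for every p ∈ U and every tangent vector v ∈ ℝ^{2n+1}, α(F(p))(DF(p)(v)) = g(p)·α(p)(v), i.e. F*α = g·α. -/
open Set Filter Topology
open scoped ContDiff

/-- A smooth family of maps, compactly supported and starting at zero, perturbs the identity
through diffeomorphisms for small parameters. -/
theorem eventually_exists_perm_id_add {E : Type*} [NormedAddCommGroup E] [NormedSpace ℝ E]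
    [CompleteSpace E] (R : ℝ → E → E) {K : Set E} (hK : IsCompact K) (h0 : ∀ x, R 0 x = 0)
    (hoff : ∀ s, ∀ x ∉ K, R s x = 0)
    (hR : ∀ᶠ s in 𝓝 0, ∀ x, ContDiffAt ℝ ∞ (Function.uncurry R) (s, x)) :
    ∀ᶠ s in 𝓝 0, ∃ f : Equiv.Perm E, (∀ x, f x = x + R s x) ∧ ContDiff ℝ ∞ f ∧
      ContDiff ℝ ∞ f.symm := by
  have hsmall : ∀ᶠ s in 𝓝 (0 : ℝ), ∀ x ∈ K, ‖fderiv ℝ (R s) x‖ < 1 / 2 := by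
    refine hK.eventually_forall_of_forall_eventually fun x _ => ?_
    have hd : ContDiffAt ℝ 0 (fun z : ℝ × E => fderiv ℝ (R z.1) z.2) (0, x) := by
      refine ContDiffAt.fderiv (n := ∞) (f := fun z : ℝ × E => R z.1) (g := Prod.snd) ?_
        contDiffAt_snd (by simp)
      exact ContDiffAt.comp (g := Function.uncurry R) (f := fun w : (ℝ × E) × E => (w.1.1, w.2))
        ((0, x), x) (hR.self_of_nhds x) (by fun_prop)
    have h0' : R 0 = fun _ => 0 := funext h0
    have hlim := hd.continuousAt.norm
    refine hlim.eventually_lt continuousAt_const ?_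
    simp [h0']
  filter_upwards [hsmall, hR] with s hs hRs
  have hsm : ContDiff ℝ ∞ (R s) := contDiff_iff_contDiffAt.2 fun x =>
    ContDiffAt.comp (g := Function.uncurry R) (f := fun y : E => (s, y)) x (hRs x) (by fun_prop)
  have hlt : ∀ x, ‖fderiv ℝ (R s) x‖ < 1 / 2 := by
    intro x
    by_cases hx : x ∈ K
    · exact hs x hx
    · have : R s =ᶠ[𝓝 x] fun _ => 0 := by
        filter_upwards [hK.isClosed.isOpen_compl.mem_nhds hx] with y hy using hoff s y hy
      simp [this.fderiv_eq]
  have hlip : LipschitzWith (1 / 2) (R s) := by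
    refine lipschitzWith_of_nnnorm_fderiv_le (hsm.differentiable (by simp)) fun x => ?_
    rw [← NNReal.coe_le_coe]
    simpa using (hlt x).le
  have happ : ApproximatesLinearOn (fun x => x + R s x)
      ((ContinuousLinearEquiv.refl ℝ E : E ≃L[ℝ] E) : E →L[ℝ] E) univ (1 / 2) := by
    intro x _ y _
    have := hlip.dist_le_mul x y
    rw [dist_eq_norm, dist_eq_norm] at this
    have e : x + R s x - (y + R s y) - (x - y) = R s x - R s y := by abel
    change ‖x + R s x - (y + R s y) - (x - y)‖ ≤ _
    rwa [e]
  have hc : Subsingleton E ∨ (1 / 2 : NNReal) < ‖(((ContinuousLinearEquiv.refl ℝ E).symm :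
      E ≃L[ℝ] E) : E →L[ℝ] E)‖₊⁻¹ := by
    rcases subsingleton_or_nontrivial E with h | h
    · exact Or.inl h
    · right
      have : ‖(((ContinuousLinearEquiv.refl ℝ E).symm : E ≃L[ℝ] E) : E →L[ℝ] E)‖₊ = 1 := by
        rw [← NNReal.coe_inj]
        simp
      rw [this, inv_one]
      rw [← NNReal.coe_lt_coe]; norm_num
  set f := happ.toHomeomorph _ hc with hf
  have hfx : ∀ x, f x = x + R s x := fun x => rfl
  have hfs : ContDiff ℝ ∞ f := by
    have : (f : E → E) = fun x => x + R s x := funext hfx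
    rw [this]; fun_prop
  refine ⟨f.toEquiv, hfx, hfs, ?_⟩
  have hunit : ∀ x, ‖-fderiv ℝ (R s) x‖ < 1 := fun x => by
    rw [norm_neg]; linarith [hlt x]
  refine f.contDiff_symm (f₀' := fun x => ContinuousLinearEquiv.unitsEquiv ℝ E
    (Units.oneSub _ (hunit x))) (fun x => ?_) hfs
  have : ((ContinuousLinearEquiv.unitsEquiv ℝ E (Units.oneSub _ (hunit x)) : E ≃L[ℝ] E) :
      E →L[ℝ] E) = ContinuousLinearMap.id ℝ E + fderiv ℝ (R s) x := by
    ext v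
    simp [ContinuousLinearEquiv.unitsEquiv_apply]
  rw [this]
  exact (hasFDerivAt_id x).add (hsm.differentiable (by simp) x).hasFDerivAt


/-- A smooth permutation pulling back the form `β` to a positive multiple of `α`. -/
structure IsContactMap {E : Type*} [NormedAddCommGroup E] [NormedSpace ℝ E]
    (α β : E → E → ℝ) (f : Equiv.Perm E) : Prop where
  contDiff : ContDiff ℝ ∞ f
  contDiff_symm : ContDiff ℝ ∞ f.symm
  exists_factor : ∀ p, ∃ c : ℝ, 0 < c ∧ ∀ v, β (f p) (fderiv ℝ f p v) = c * α p v

namespace IsContactMap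

variable {E : Type*} [NormedAddCommGroup E] [NormedSpace ℝ E] {α β γ : E → E → ℝ}
  {f g : Equiv.Perm E}

theorem refl (α : E → E → ℝ) : IsContactMap α α (Equiv.refl E) where
  contDiff := contDiff_id
  contDiff_symm := contDiff_id
  exists_factor p := ⟨1, one_pos, fun v => by simp⟩

theorem trans (hf : IsContactMap α β f) (hg : IsContactMap β γ g) :
    IsContactMap α γ (f.trans g) where
  contDiff := hg.contDiff.comp hf.contDiff
  contDiff_symm := hf.contDiff_symm.comp hg.contDiff_symm
  exists_factor p := by
    obtain ⟨c, hc, h⟩ := hf.exists_factor p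
    obtain ⟨d, hd, h'⟩ := hg.exists_factor (f p)
    refine ⟨d * c, mul_pos hd hc, fun v => ?_⟩
    have : fderiv ℝ (f.trans g) p = (fderiv ℝ g (f p)).comp (fderiv ℝ f p) :=
      fderiv_comp p (hg.contDiff.differentiable (by simp) _)
        (hf.contDiff.differentiable (by simp) _)
    rw [this, ContinuousLinearMap.comp_apply, Equiv.trans_apply, h', h, mul_assoc]

theorem symm (hf : IsContactMap α β f) : IsContactMap β α f.symm where
  contDiff := hf.contDiff_symm
  contDiff_symm := hf.contDiff
  exists_factor q := by
    obtain ⟨c, hc, h⟩ := hf.exists_factor (f.symm q)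
    refine ⟨c⁻¹, inv_pos.2 hc, fun v => ?_⟩
    have hcomp : (fderiv ℝ f (f.symm q)).comp (fderiv ℝ f.symm q) =
        ContinuousLinearMap.id ℝ E := by
      rw [← fderiv_comp q (hf.contDiff.differentiable (by simp) _)
        (hf.contDiff_symm.differentiable (by simp) _), ← fderiv_id (x := q)]
      congr 1
      exact funext f.apply_symm_apply
    have hv : fderiv ℝ f (f.symm q) (fderiv ℝ f.symm q v) = v :=
      DFunLike.congr_fun hcomp v
    have := h (fderiv ℝ f.symm q v)
    rw [hv, f.apply_symm_apply] at this
    rw [this, inv_mul_cancel_left₀ hc.ne']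

end IsContactMap

/-- The space `ℝ^{2n+1}`. -/
abbrev ContactSpace (n : ℕ) := (Fin n → ℝ) × (Fin n → ℝ) × ℝ

/-- The form `dz - Σ pᵢ dqᵢ` in coordinates `(q, p, z)`. -/
def jetForm (n : ℕ) (p v : ContactSpace n) : ℝ :=
  v.2.2 - ∑ i, p.2.1 i * v.1 i

/-- The form `dz + Σ (xᵢ dyᵢ - yᵢ dxᵢ)` in coordinates `(x, y, z)`. -/
def stdForm (n : ℕ) (p v : ContactSpace n) : ℝ :=
  v.2.2 + ∑ i, (p.1 i * v.2.1 i - p.2.1 i * v.1 i)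

theorem clm_apply_eq_sum {n : ℕ} (L : ContactSpace n →L[ℝ] ℝ)
    (v : ContactSpace n) :
    L v = ∑ i, v.1 i * L (Pi.single i 1, 0, 0) + ∑ i, v.2.1 i * L (0, Pi.single i 1, 0) +
      v.2.2 * L (0, 0, 1) := by
  obtain ⟨x, y, z⟩ := v
  have single_eq_ite : ∀ i : Fin n, (Pi.single i 1 : Fin n → ℝ) = fun j => if i = j then 1 else 0 :=
    fun i => by ext j; simp [Pi.single_apply, eq_comm]
  have hx : L (x, 0, 0) = ∑ i, x i * L (Pi.single i 1, 0, 0) := by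
    simp only [single_eq_ite]
    exact LinearMap.pi_apply_eq_sum_univ
      ((L.comp (ContinuousLinearMap.inl ℝ _ _)).toLinearMap) x
  have hy : L (0, y, 0) = ∑ i, y i * L (0, Pi.single i 1, 0) := by
    simp only [single_eq_ite]
    exact LinearMap.pi_apply_eq_sum_univ
      ((L.comp ((ContinuousLinearMap.inr ℝ _ _).comp
        (ContinuousLinearMap.inl ℝ _ _))).toLinearMap) y
  have hz : L (0, 0, z) = z * L (0, 0, 1) := by
    rw [← smul_eq_mul, ← map_smul]; simp
  have : (x, y, z) = (x, 0, 0) + ((0, y, 0) + (0, 0, z)) := by simp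
  rw [this, map_add, map_add, hx, hy, hz]
  simp [add_assoc]

/-- Contactomorphisms of `dz - p dq` defined by a small generating function `z - P q + h`. -/
theorem eventually_exists_contact_of_generating {n : ℕ}
    (h : ℝ → ContactSpace n → ℝ) (hsm : ContDiff ℝ ∞ (Function.uncurry h))
    {K : Set (ContactSpace n)} (hK : IsCompact K) (h0 : ∀ x, h 0 x = 0)
    (hoff : ∀ s, ∀ x ∉ K, h s x = 0) :
    ∀ᶠ s in 𝓝 0, ∃ Φ : Equiv.Perm (ContactSpace n),
      IsContactMap (jetForm n) (jetForm n) Φ ∧ (∀ x ∉ K, Φ x = x) ∧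
      ∀ a : ContactSpace n,
        Φ (a.1, (1 + fderiv ℝ (h s) a (0, 0, 1))⁻¹ •
            (a.2.1 - fun i => fderiv ℝ (h s) a (Pi.single i 1, 0, 0)), a.2.2) =
          (a.1 - fun i => fderiv ℝ (h s) a (0, Pi.single i 1, 0), a.2.1,
            a.2.2 + (h s a - ∑ i, a.2.1 i * fderiv ℝ (h s) a (0, Pi.single i 1, 0))) := by
  have hdsm : ContDiff ℝ ∞ (fun w : ℝ × ContactSpace n => fderiv ℝ (h w.1) w.2) := by
    refine ContDiff.fderiv (m := ∞) (f := fun w : ℝ × ContactSpace n => h w.1) (g := Prod.snd) ?_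
      contDiff_snd (by simp)
    exact hsm.comp (g := Function.uncurry h)
      (f := fun w : (ℝ × ContactSpace n) × ContactSpace n => (w.1.1, w.2)) (by fun_prop)
  have hdv : ∀ v : ContactSpace n,
      ContDiff ℝ ∞ (fun w : ℝ × ContactSpace n => fderiv ℝ (h w.1) w.2 v) := fun v =>
    hdsm.clm_apply contDiff_const
  have hd0 : ∀ x, fderiv ℝ (h 0) x = 0 := fun x => by
    rw [show h 0 = fun _ => 0 from funext h0]; simp
  have hdoff : ∀ s, ∀ x ∉ K, fderiv ℝ (h s) x = 0 := fun s x hx => by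
    have : h s =ᶠ[𝓝 x] fun _ => 0 := by
      filter_upwards [hK.isClosed.isOpen_compl.mem_nhds hx] with y hy using hoff s y hy
    simp [this.fderiv_eq]
  have hpos : ∀ᶠ s in 𝓝 (0 : ℝ), ∀ a, 0 < 1 + fderiv ℝ (h s) a (0, 0, 1) := by
    have : ∀ᶠ s in 𝓝 (0 : ℝ), ∀ a ∈ K, 0 < 1 + fderiv ℝ (h s) a (0, 0, 1) := by
      refine hK.eventually_forall_of_forall_eventually fun x _ => ?_
      have := ((hdv (0, 0, 1)).continuous.const_add 1).continuousAt (x := ((0 : ℝ), x))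
      exact continuousAt_const.eventually_lt this (by simp [hd0])
    filter_upwards [this] with s hs a
    by_cases ha : a ∈ K
    · exact hs a ha
    · simp [hdoff s a ha]
  let R₁ : ℝ → ContactSpace n → ContactSpace n := fun s a =>
    (0, (1 + fderiv ℝ (h s) a (0, 0, 1))⁻¹ •
    (a.2.1 - fun i => fderiv ℝ (h s) a (Pi.single i 1, 0, 0)) - a.2.1, 0)
  let R₂ : ℝ → ContactSpace n → ContactSpace n := fun s a =>
    (-fun i => fderiv ℝ (h s) a (0, Pi.single i 1, 0), 0,
    h s a - ∑ i, a.2.1 i * fderiv ℝ (h s) a (0, Pi.single i 1, 0))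
  have hR₁ : ∀ᶠ s in 𝓝 0, ∀ x, ContDiffAt ℝ ∞ (Function.uncurry R₁) (s, x) := by
    filter_upwards [hpos] with s hs x
    have h1 : ContDiff ℝ ∞ (fun w : ℝ × ContactSpace n =>
        fun i => fderiv ℝ (h w.1) w.2 (Pi.single i 1, 0, 0)) :=
      contDiff_pi.2 fun i => hdv _
    have h2 : ContDiffAt ℝ ∞
        (fun w : ℝ × ContactSpace n => (1 + fderiv ℝ (h w.1) w.2 (0, 0, 1))⁻¹) (s, x) :=
      ContDiffAt.inv (contDiffAt_const.add (hdv (0, 0, 1)).contDiffAt) (hs x).ne'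
    have h3 : ContDiff ℝ ∞ (fun w : ℝ × ContactSpace n => w.2.2.1) := by fun_prop
    exact contDiffAt_const.prodMk (((h2.smul (h3.sub h1).contDiffAt).sub
      h3.contDiffAt).prodMk contDiffAt_const)
  have hR₂ : ContDiff ℝ ∞ (Function.uncurry R₂) := by
    have h1 : ContDiff ℝ ∞ (fun w : ℝ × ContactSpace n =>
        fun i => fderiv ℝ (h w.1) w.2 (0, Pi.single i 1, 0)) :=
      contDiff_pi.2 fun i => hdv _
    refine h1.neg.prodMk (contDiff_const.prodMk (hsm.sub (ContDiff.sum fun i _ => ?_)))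
    have := hdv (0, Pi.single i 1, 0)
    exact ContDiff.mul (by fun_prop) this
  have e₁ := eventually_exists_perm_id_add R₁ hK (fun x => by simp [R₁, hd0]; rfl)
    (fun s x hx => by
      simp only [R₁, hdoff s x hx]; ext <;> simp) hR₁
  have e₂ := eventually_exists_perm_id_add R₂ hK
    (fun x => by simp only [R₂, hd0, h0]; ext <;> simp)
    (fun s x hx => by simp only [R₂, hdoff s x hx, hoff s x hx]; ext <;> simp)
    (Eventually.of_forall fun s x => hR₂.contDiffAt)
  filter_upwards [e₁, e₂, hpos] with s ⟨f₁, hf₁, hf₁s, hf₁s'⟩ ⟨f₂, hf₂, hf₂s, hf₂s'⟩ hs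
  have hf₁' : ∀ a, f₁ a = (a.1, (1 + fderiv ℝ (h s) a (0, 0, 1))⁻¹ •
            (a.2.1 - fun i => fderiv ℝ (h s) a (Pi.single i 1, 0, 0)), a.2.2) := fun a => by
    rw [hf₁]; ext <;> simp [R₁]
  have hf₂' : ∀ a, f₂ a = (a.1 - fun i => fderiv ℝ (h s) a (0, Pi.single i 1, 0), a.2.1,
            a.2.2 + (h s a - ∑ i, a.2.1 i * fderiv ℝ (h s) a (0, Pi.single i 1, 0))) :=
    fun a => by rw [hf₂]; ext <;> simp [R₂, sub_eq_add_neg]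
  have hfix₁ : ∀ x ∉ K, f₁ x = x := fun x hx => by
    rw [hf₁']; ext <;> simp [hdoff s x hx]
  have hfix₂ : ∀ x ∉ K, f₂ x = x := fun x hx => by
    rw [hf₂']; ext <;> simp [hdoff s x hx, hoff s x hx]
  let γ : ContactSpace n → ContactSpace n → ℝ := fun a v => jetForm n (f₁ a) (fderiv ℝ f₁ a v)
  have hc₁ : IsContactMap γ (jetForm n) f₁ :=
    ⟨hf₁s, hf₁s', fun p => ⟨1, one_pos, fun v => (one_mul _).symm⟩⟩
  have hc₂ : IsContactMap γ (jetForm n) f₂ := by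
    refine ⟨hf₂s, hf₂s', fun a => ⟨_, hs a, fun v => ?_⟩⟩
    have hhd : HasFDerivAt (h s) (fderiv ℝ (h s) a) a := by
      have : ContDiff ℝ ∞ (h s) := hsm.comp (g := Function.uncurry h)
        (f := fun y : ContactSpace n => (s, y)) (by fun_prop)
      exact (this.differentiable (by simp) a).hasFDerivAt
    have hPd : ∀ i, DifferentiableAt ℝ
        (fun b => fderiv ℝ (h s) b (0, Pi.single i 1, 0)) a := fun i => by
      have : ContDiff ℝ ∞ (fun b => fderiv ℝ (h s) b (0, Pi.single i 1, 0)) :=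
        (hdv (0, Pi.single i 1, 0)).comp (f := fun y : ContactSpace n => (s, y)) (by fun_prop)
      exact this.differentiable (by simp) a
    have d₁ := (hf₁s.differentiable (by simp) a).hasFDerivAt
    have d₂ := (hf₂s.differentiable (by simp) a).hasFDerivAt
    have d₁q : (fderiv ℝ f₁ a v).1 = v.1 := by
      have h1 : HasFDerivAt (fun b => (f₁ b).1) (ContinuousLinearMap.fst ℝ _ _) a := by
        simp only [hf₁']; exact hasFDerivAt_fst
      exact DFunLike.congr_fun (d₁.fst.unique h1) v
    have d₁z : (fderiv ℝ f₁ a v).2.2 = v.2.2 := by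
      have h1 : HasFDerivAt (fun b => (f₁ b).2.2) ((ContinuousLinearMap.snd ℝ _ _).comp
          (ContinuousLinearMap.snd ℝ _ _)) a := by
        simp only [hf₁']; exact hasFDerivAt_snd.snd
      exact DFunLike.congr_fun (d₁.snd.snd.unique h1) v
    have d₂q : ∀ i, (fderiv ℝ f₂ a v).1 i = v.1 i -
        fderiv ℝ (fun b => fderiv ℝ (h s) b (0, Pi.single i 1, 0)) a v := fun i => by
      have h1 : HasFDerivAt (fun b => (f₂ b).1 i)
          ((ContinuousLinearMap.proj i).comp (ContinuousLinearMap.fst ℝ _ _) -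
            fderiv ℝ (fun b => fderiv ℝ (h s) b (0, Pi.single i 1, 0)) a) a := by
        have h2 : HasFDerivAt (fun b : ContactSpace n => b.1 i)
            ((ContinuousLinearMap.proj i).comp (ContinuousLinearMap.fst ℝ _ _)) a :=
          ((ContinuousLinearMap.proj (R := ℝ) (φ := fun _ : Fin n => ℝ) i).comp
            (ContinuousLinearMap.fst ℝ (Fin n → ℝ) ((Fin n → ℝ) × ℝ))).hasFDerivAt
        simp only [hf₂', Pi.sub_apply]
        exact h2.sub (hPd i).hasFDerivAt
      exact DFunLike.congr_fun ((hasFDerivAt_pi'.1 d₂.fst i).unique h1) v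
    have d₂z : (fderiv ℝ f₂ a v).2.2 = v.2.2 + (fderiv ℝ (h s) a v - ∑ i,
        (a.2.1 i * fderiv ℝ (fun b => fderiv ℝ (h s) b (0, Pi.single i 1, 0)) a v +
          fderiv ℝ (h s) a (0, Pi.single i 1, 0) * v.2.1 i)) := by
      have h1 : HasFDerivAt (fun b => (f₂ b).2.2)
          ((ContinuousLinearMap.snd ℝ _ _).comp (ContinuousLinearMap.snd ℝ _ _) +
            (fderiv ℝ (h s) a - ∑ i,
              (a.2.1 i • fderiv ℝ (fun b => fderiv ℝ (h s) b (0, Pi.single i 1, 0)) a +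
              fderiv ℝ (h s) a (0, Pi.single i 1, 0) • (ContinuousLinearMap.proj i).comp
                ((ContinuousLinearMap.fst ℝ _ _).comp (ContinuousLinearMap.snd ℝ _ _))))) a := by
        simp only [hf₂']
        refine HasFDerivAt.add hasFDerivAt_snd.snd (hhd.sub (HasFDerivAt.fun_sum fun i _ => ?_))
        exact (hasFDerivAt_pi'.1 hasFDerivAt_snd.fst i).mul (hPd i).hasFDerivAt
      have h2 := DFunLike.congr_fun (d₂.snd.snd.unique h1) v
      exact h2.trans (by simp)
    have hv := clm_apply_eq_sum (fderiv ℝ (h s) a) v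
    simp only [γ, jetForm, d₁q, d₁z, d₂q, d₂z, hf₁', hf₂', Pi.smul_apply, Pi.sub_apply,
      smul_eq_mul]
    have hne := (hs a).ne'
    rw [hv, mul_sub, Finset.mul_sum]
    have hinv : ∀ i, (1 + fderiv ℝ (h s) a (0, 0, 1)) * ((1 + fderiv ℝ (h s) a (0, 0, 1))⁻¹ *
        (a.2.1 i - fderiv ℝ (h s) a (Pi.single i 1, 0, 0)) * v.1 i) =
        (a.2.1 i - fderiv ℝ (h s) a (Pi.single i 1, 0, 0)) * v.1 i := fun i => by
      field_simp
    simp only [hinv]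
    simp only [mul_sub, sub_mul, Finset.sum_add_distrib, Finset.sum_sub_distrib,
      mul_comm (v.1 _), mul_comm (v.2.1 _)]
    ring
  refine ⟨f₁.symm.trans f₂, hc₁.symm.trans hc₂, fun x hx => ?_, fun a => ?_⟩
  · have : f₁.symm x = x := by rw [Equiv.symm_apply_eq, hfix₁ x hx]
    simp [this, hfix₂ x hx]
  · rw [← hf₁', ← hf₂']; simp

/-- The anisotropic dilation `(x, y, z) ↦ (a x, a y, a² z)`. -/
def dil (n : ℕ) (a : ℝ) (p : ContactSpace n) : ContactSpace n := (a • p.1, a • p.2.1, a ^ 2 * p.2.2)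

theorem dil_dil {n : ℕ} (a b : ℝ) (p : ContactSpace n) : dil n a (dil n b p) = dil n (a * b) p := by
  simp only [dil, smul_smul, mul_pow, mul_assoc]

@[simp] theorem dil_one {n : ℕ} (p : ContactSpace n) : dil n 1 p = p := by simp [dil]

theorem continuous_dil (n : ℕ) : Continuous (fun w : ℝ × ContactSpace n => dil n w.1 w.2) := by
  unfold dil; fun_prop

theorem norm_dil_le {n : ℕ} {a : ℝ} (h0 : 0 ≤ a) (h1 : a ≤ 1) (p : ContactSpace n) :
    ‖dil n a p‖ ≤ a * ‖p‖ := by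
  have hx : ‖p.1‖ ≤ ‖p‖ := norm_fst_le p
  have hy : ‖p.2.1‖ ≤ ‖p‖ := (norm_fst_le p.2).trans (norm_snd_le p)
  have hz : ‖p.2.2‖ ≤ ‖p‖ := (norm_snd_le p.2).trans (norm_snd_le p)
  have hp := norm_nonneg p
  simp only [dil, Prod.norm_def, norm_smul, norm_mul, norm_pow, Real.norm_of_nonneg h0] at *
  refine max_le (by gcongr) (max_le (by gcongr) ?_)
  calc a ^ 2 * ‖p.2.2‖ ≤ a * ‖p.2.2‖ := by gcongr; nlinarith
    _ ≤ _ := by gcongr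

/-- The time-`s` flow of `2z ∂/∂z + Σ (xᵢ ∂/∂xᵢ + yᵢ ∂/∂yᵢ)`. -/
noncomputable def dilPerm (n : ℕ) (s : ℝ) : Equiv.Perm (ContactSpace n) where
  toFun := dil n (Real.exp s)
  invFun := dil n (Real.exp (-s))
  left_inv p := by rw [dil_dil, ← Real.exp_add]; simp
  right_inv p := by rw [dil_dil, ← Real.exp_add]; simp

theorem dilPerm_apply {n : ℕ} (s : ℝ) (p : ContactSpace n) :
    dilPerm n s p = dil n (Real.exp s) p := rfl

theorem dilPerm_symm_apply {n : ℕ} (s : ℝ) (p : ContactSpace n) :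
    (dilPerm n s).symm p = dil n (Real.exp (-s)) p := rfl

theorem isContactMap_dilPerm (n : ℕ) (s : ℝ) :
    IsContactMap (stdForm n) (stdForm n) (dilPerm n s) where
  contDiff := by
    change ContDiff ℝ ∞ (dil n (Real.exp s)); unfold dil; fun_prop
  contDiff_symm := by
    change ContDiff ℝ ∞ (dil n (Real.exp (-s))); unfold dil; fun_prop
  exists_factor p := by
    refine ⟨Real.exp s ^ 2, by positivity, fun v => ?_⟩
    let L : ContactSpace n →L[ℝ] ContactSpace n := (Real.exp s • ContinuousLinearMap.fst ℝ _ _).prod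
        ((Real.exp s • (ContinuousLinearMap.fst ℝ _ _).comp (ContinuousLinearMap.snd ℝ _ _)).prod
        (Real.exp s ^ 2 •
          (ContinuousLinearMap.snd ℝ _ _).comp (ContinuousLinearMap.snd ℝ _ _)))
    have : HasFDerivAt (dilPerm n s) L p := L.hasFDerivAt
    rw [this.fderiv]
    simp only [L, stdForm, dilPerm_apply, dil, ContinuousLinearMap.prod_apply,
      smul_apply, ContinuousLinearMap.comp_apply, ContinuousLinearMap.coe_fst',
      ContinuousLinearMap.coe_snd', Pi.smul_apply, smul_eq_mul]
    rw [mul_add, Finset.mul_sum]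
    congr 1
    exact Finset.sum_congr rfl fun i _ => by ring

/-- For small times, the dilation flow near a compact set can be cut off to a contactomorphism of
`dz - p dq` supported in a prescribed neighbourhood. -/
theorem eventually_exists_jet_cutoff {n : ℕ} {C V : Set (ContactSpace n)} (hC : IsCompact C)
    (hV : IsOpen V) (hCV : C ⊆ V) :
    ∀ᶠ s in 𝓝 0, ∃ Φ : Equiv.Perm (ContactSpace n),
      IsContactMap (jetForm n) (jetForm n) Φ ∧ (∀ x ∉ V, Φ x = x) ∧
      ∀ x ∈ C, Φ x = dil n (Real.exp s) x := by
  obtain ⟨L, hL, hCL, hLV⟩ := exists_compact_between hC hV hCV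
  obtain ⟨K, hK, hLK, hKV⟩ := exists_compact_between hL hV hLV
  obtain ⟨χ, hχ0, hχ1, -⟩ := exists_contMDiffMap_zero_one_of_isClosed
    (modelWithCornersSelf ℝ (ContactSpace n)) (n := (⊤ : ℕ∞))
    (isOpen_interior.isClosed_compl (s := interior K)) hL.isClosed
    (disjoint_compl_left_iff_subset.2 hLK)
  have hχ : ContDiff ℝ ∞ χ := χ.contMDiff.contDiff
  let k : ℝ → ContactSpace n → ℝ := fun s a =>
    (Real.exp s ^ 2 - 1) * a.2.2 - (Real.exp s - 1) * ∑ i, a.2.1 i * a.1 i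
  have hk : ContDiff ℝ ∞ (Function.uncurry k) := by
    have : ContDiff ℝ ∞ (fun w : ℝ × ContactSpace n => Real.exp w.1) :=
      Real.contDiff_exp.comp contDiff_fst
    exact (((this.pow 2).sub contDiff_const).mul (by fun_prop)).sub
      ((this.sub contDiff_const).mul (ContDiff.sum fun i _ => by fun_prop))
  have hgen := eventually_exists_contact_of_generating (fun s a => χ a * k s a)
    ((hχ.comp contDiff_snd).mul hk) hK (fun x => by simp [k])
    (fun s x hx => by
      have : χ x = 0 := hχ0 fun h => hx (interior_subset h)
      simp [this])
  have hnear : ∀ᶠ s in 𝓝 (0 : ℝ), ∀ c ∈ C, (c.1, Real.exp s • c.2.1, c.2.2) ∈ interior L := by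
    refine hC.eventually_forall_of_forall_eventually fun c hc => ?_
    have hcont : Continuous (fun w : ℝ × ContactSpace n =>
      ((w.2.1, Real.exp w.1 • w.2.2.1, w.2.2.2) : ContactSpace n)) := by fun_prop
    exact hcont.continuousAt.eventually_mem (isOpen_interior.mem_nhds (by simpa using hCL hc))
  filter_upwards [hgen, hnear] with s ⟨Φ, hΦ, hoff, happ⟩ hs
  refine ⟨Φ, hΦ, fun x hx => hoff x fun h => hx (hKV h), fun c hc => ?_⟩
  set a : ContactSpace n := (c.1, Real.exp s • c.2.1, c.2.2) with ha
  have hev : (fun b => χ b * k s b) =ᶠ[𝓝 a] k s := by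
    filter_upwards [isOpen_interior.mem_nhds (hs c hc)] with b hb
    have : χ b = 1 := hχ1 (interior_subset hb)
    simp [this]
  have hd : HasFDerivAt (k s) ((Real.exp s ^ 2 - 1) •
      (ContinuousLinearMap.snd ℝ _ _).comp (ContinuousLinearMap.snd ℝ _ _) -
      (Real.exp s - 1) • ∑ i, (a.2.1 i • (ContinuousLinearMap.proj i).comp
          (ContinuousLinearMap.fst ℝ _ _) + a.1 i • (ContinuousLinearMap.proj i).comp
          ((ContinuousLinearMap.fst ℝ _ _).comp (ContinuousLinearMap.snd ℝ _ _)))) a := by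
    refine HasFDerivAt.sub (hasFDerivAt_snd.snd.const_mul _)
      ((HasFDerivAt.fun_sum fun i _ => ?_).const_mul _)
    have hq : HasFDerivAt (fun b : ContactSpace n => b.1 i)
        ((ContinuousLinearMap.proj i).comp (ContinuousLinearMap.fst ℝ _ _)) a :=
      ((ContinuousLinearMap.proj (R := ℝ) (φ := fun _ : Fin n => ℝ) i).comp
        (ContinuousLinearMap.fst ℝ (Fin n → ℝ) ((Fin n → ℝ) × ℝ))).hasFDerivAt
    have hp : HasFDerivAt (fun b : ContactSpace n => b.2.1 i)
        ((ContinuousLinearMap.proj i).comp ((ContinuousLinearMap.fst ℝ _ _).comp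
          (ContinuousLinearMap.snd ℝ _ _))) a :=
      hasFDerivAt_pi'.1 hasFDerivAt_snd.fst i
    exact hp.mul hq
  have hz : fderiv ℝ (fun b => χ b * k s b) a (0, 0, 1) = Real.exp s ^ 2 - 1 := by
    rw [hev.fderiv_eq, hd.fderiv]
    simp
  have hq : ∀ i, fderiv ℝ (fun b => χ b * k s b) a (Pi.single i 1, 0, 0) =
      -((Real.exp s - 1) * a.2.1 i) := fun i => by
    rw [hev.fderiv_eq, hd.fderiv]
    simp [Pi.single_apply]
  have hp : ∀ i, fderiv ℝ (fun b => χ b * k s b) a (0, Pi.single i 1, 0) =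
      -((Real.exp s - 1) * a.1 i) := fun i => by
    rw [hev.fderiv_eq, hd.fderiv]
    simp [Pi.single_apply]
  have hval : χ a * k s a = k s a := hev.self_of_nhds
  have happ' := happ a
  simp only [hz, hq, hp, hval] at happ'
  convert happ' using 1
  · congr 1
    refine Prod.ext rfl (Prod.ext (funext fun i => ?_) rfl)
    simp only [ha, Pi.smul_apply, Pi.sub_apply, smul_eq_mul]
    field_simp
    ring
  · refine Prod.ext (funext fun i => ?_) (Prod.ext rfl ?_)
    · simp only [dil, ha, Pi.smul_apply, Pi.sub_apply, smul_eq_mul]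
      ring
    · have : ∑ i, a.2.1 i * -((Real.exp s - 1) * a.1 i) =
          -((Real.exp s - 1) * ∑ i, a.2.1 i * a.1 i) := by
        rw [Finset.mul_sum, ← Finset.sum_neg_distrib]
        exact Finset.sum_congr rfl fun i _ => by ring
      change Real.exp s ^ 2 * a.2.2 = a.2.2 + (k s a - _)
      rw [this]
      ring

/-- The coordinate change `(x, y, z) ↦ (x, 2y, z + xy)` taking `dz + x dy - y dx` to
`dz - p dq`. -/
noncomputable def stdToJet (n : ℕ) : Equiv.Perm (ContactSpace n) where
  toFun p := (p.1, (2 : ℝ) • p.2.1, p.2.2 + ∑ i, p.1 i * p.2.1 i)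
  invFun p := (p.1, (2⁻¹ : ℝ) • p.2.1, p.2.2 - ∑ i, p.1 i * (2⁻¹ * p.2.1 i))
  left_inv p := by simp [smul_smul]
  right_inv p := by simp [smul_smul]

theorem stdToJet_apply {n : ℕ} (p : ContactSpace n) :
    stdToJet n p = (p.1, (2 : ℝ) • p.2.1, p.2.2 + ∑ i, p.1 i * p.2.1 i) := rfl

theorem stdToJet_dil {n : ℕ} (a : ℝ) (p : ContactSpace n) :
    stdToJet n (dil n a p) = dil n a (stdToJet n p) := by
  simp only [stdToJet_apply, dil, Pi.smul_apply, smul_eq_mul, mul_add, Finset.mul_sum]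
  refine Prod.ext rfl (Prod.ext (smul_comm _ _ _) ?_)
  dsimp only
  congr 1
  exact Finset.sum_congr rfl fun i _ => by ring

theorem isContactMap_stdToJet (n : ℕ) : IsContactMap (stdForm n) (jetForm n) (stdToJet n) where
  contDiff := by
    change ContDiff ℝ ∞ fun p : ContactSpace n =>
      ((p.1, (2 : ℝ) • p.2.1, p.2.2 + ∑ i, p.1 i * p.2.1 i) : ContactSpace n)
    have : ContDiff ℝ ∞ fun p : ContactSpace n => ∑ i, p.1 i * p.2.1 i :=
      ContDiff.sum fun i _ => by fun_prop
    fun_prop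
  contDiff_symm := by
    change ContDiff ℝ ∞ fun p : ContactSpace n =>
      ((p.1, (2⁻¹ : ℝ) • p.2.1, p.2.2 - ∑ i, p.1 i * (2⁻¹ * p.2.1 i)) : ContactSpace n)
    have : ContDiff ℝ ∞ fun p : ContactSpace n => ∑ i, p.1 i * (2⁻¹ * p.2.1 i) :=
      ContDiff.sum fun i _ => by fun_prop
    fun_prop
  exists_factor p := by
    refine ⟨1, one_pos, fun v => ?_⟩
    have hd : HasFDerivAt (stdToJet n) ((ContinuousLinearMap.fst ℝ _ _).prod
        (((2 : ℝ) • (ContinuousLinearMap.fst ℝ _ _).comp (ContinuousLinearMap.snd ℝ _ _)).prod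
        ((ContinuousLinearMap.snd ℝ _ _).comp (ContinuousLinearMap.snd ℝ _ _) +
          ∑ i, (p.1 i • (ContinuousLinearMap.proj i).comp
          ((ContinuousLinearMap.fst ℝ _ _).comp (ContinuousLinearMap.snd ℝ _ _)) +
          p.2.1 i • (ContinuousLinearMap.proj i).comp (ContinuousLinearMap.fst ℝ _ _))))) p := by
      refine hasFDerivAt_fst.prodMk ((hasFDerivAt_snd.fst.const_smul (2 : ℝ)).prodMk
        (HasFDerivAt.add hasFDerivAt_snd.snd (HasFDerivAt.fun_sum fun i _ => ?_)))
      have hq : HasFDerivAt (fun b : ContactSpace n => b.1 i)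
          ((ContinuousLinearMap.proj i).comp (ContinuousLinearMap.fst ℝ _ _)) p :=
        ((ContinuousLinearMap.proj (R := ℝ) (φ := fun _ : Fin n => ℝ) i).comp
          (ContinuousLinearMap.fst ℝ (Fin n → ℝ) ((Fin n → ℝ) × ℝ))).hasFDerivAt
      have hp : HasFDerivAt (fun b : ContactSpace n => b.2.1 i)
          ((ContinuousLinearMap.proj i).comp ((ContinuousLinearMap.fst ℝ _ _).comp
            (ContinuousLinearMap.snd ℝ _ _))) p :=
        hasFDerivAt_pi'.1 hasFDerivAt_snd.fst i
      exact hq.mul hp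
    rw [hd.fderiv]
    simp [jetForm, stdForm, stdToJet_apply]
    rw [add_sub_assoc, ← Finset.sum_sub_distrib, ← Finset.sum_sub_distrib]
    congr 1
    exact Finset.sum_congr rfl fun i _ => by ring

theorem eventually_exists_cutoff {n : ℕ} {C V : Set (ContactSpace n)} (hC : IsCompact C)
    (hV : IsOpen V) (hCV : C ⊆ V) :
    ∀ᶠ s in 𝓝 0, ∃ Φ : Equiv.Perm (ContactSpace n),
      IsContactMap (stdForm n) (stdForm n) Φ ∧ (∀ x ∉ V, Φ x = x) ∧
      ∀ x ∈ C, Φ x = dil n (Real.exp s) x := by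
  have hT := isContactMap_stdToJet n
  have h := eventually_exists_jet_cutoff (hC.image hT.contDiff.continuous)
    (hV.preimage hT.contDiff_symm.continuous) (by
      rintro _ ⟨x, hx, rfl⟩
      simpa using hCV hx)
  filter_upwards [h] with s ⟨Φ, hΦ, hoff, hon⟩
  refine ⟨((stdToJet n).trans Φ).trans (stdToJet n).symm, (hT.trans hΦ).trans hT.symm,
    fun x hx => ?_, fun x hx => ?_⟩
  · have := hoff (stdToJet n x) (by simpa using hx)
    simp [this]
  · have := hon _ (mem_image_of_mem _ hx)
    simp [this, ← stdToJet_dil]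

/-- The backward dilation flow on a compact star-shaped set extends, for every time, to a
contactomorphism supported in a prescribed neighbourhood. -/
theorem exists_contact_eq_dil {n : ℕ} {C V : Set (ContactSpace n)} (hC : IsCompact C)
    (hV : IsOpen V) (hCV : C ⊆ V) (hstar : ∀ s : ℝ, 0 ≤ s → ∀ x ∈ C, dil n (Real.exp (-s)) x ∈ C)
    {t : ℝ} (ht : 0 ≤ t) :
    ∃ Φ : Equiv.Perm (ContactSpace n),
      IsContactMap (stdForm n) (stdForm n) Φ ∧ (∀ x ∉ V, Φ x = x) ∧
      ∀ x ∈ C, Φ x = dil n (Real.exp (-t)) x := by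
  have hlim : Tendsto (fun m : ℕ => -(t / (m + 1 : ℝ))) atTop (𝓝 0) := by
    have := (tendsto_one_div_add_atTop_nhds_zero_nat (𝕜 := ℝ)).const_mul (-t)
    rw [mul_zero] at this
    exact this.congr fun m => by ring
  obtain ⟨m, Φ, hΦ, hoff, hon⟩ := (hlim.eventually (eventually_exists_cutoff hC hV hCV)).exists
  have key : ∀ j : ℕ, ∃ Ψ : Equiv.Perm (ContactSpace n),
      IsContactMap (stdForm n) (stdForm n) Ψ ∧ (∀ x ∉ V, Ψ x = x) ∧
      ∀ x ∈ C, Ψ x = dil n (Real.exp (-(j * (t / (m + 1 : ℝ))))) x := by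
    intro j
    induction j with
    | zero => exact ⟨Equiv.refl _, IsContactMap.refl _, fun x _ => rfl, fun x _ => by simp⟩
    | succ j ih =>
      obtain ⟨Ψ, hΨ, hoff', hon'⟩ := ih
      refine ⟨Ψ.trans Φ, hΨ.trans hΦ, fun x hx => by simp [hoff' x hx, hoff x hx],
        fun x hx => ?_⟩
      rw [Equiv.trans_apply, hon' x hx, hon _ (hstar _ (by positivity) x hx), dil_dil,
        ← Real.exp_add]
      congr 2
      push_cast
      ring
  obtain ⟨Ψ, hΨ, hoff', hon'⟩ := key (m + 1)
  refine ⟨Ψ, hΨ, hoff', fun x hx => ?_⟩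
  rw [hon' x hx]
  congr 3
  push_cast
  field_simp

theorem Equiv.Perm.apply_mem_iff_of_forall_notMem {X : Type*} {f : Equiv.Perm X} {V : Set X}
    (h : ∀ x ∉ V, f x = x) (x : X) : f x ∈ V ↔ x ∈ V := by
  refine ⟨fun hx => ?_, fun hx => ?_⟩
  · by_contra hxV
    rw [h x hxV] at hx
    exact hxV hx
  · by_contra hfx
    rw [f.injective (h _ hfx)] at hfx
    exact hfx hx

/-- A contactomorphism supported in a star-shaped open set agrees on a small ball with the
contracted version of one whose image of the ball engulfs a given compact subset. -/
theorem exists_engulfing {n : ℕ} {U : Set (ContactSpace n)} (hU : IsOpen U)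
    (hstar : ∀ a ∈ Icc (0 : ℝ) 1, ∀ x ∈ U, dil n a x ∈ U) {r : ℝ} (hr : 0 < r)
    (hball : Metric.closedBall 0 r ⊆ U) {K : Set (ContactSpace n)} (hK : IsCompact K)
    (hKU : K ⊆ U) {Φ : Equiv.Perm (ContactSpace n)}
    (hΦ : IsContactMap (stdForm n) (stdForm n) Φ) (hoff : ∀ x ∉ U, Φ x = x) :
    ∃ Θ : Equiv.Perm (ContactSpace n), IsContactMap (stdForm n) (stdForm n) Θ ∧
      (∀ x ∉ U, Θ x = x) ∧ (∀ b ∈ Metric.ball 0 r, Θ (dil n (Real.exp (-1)) b) = Φ b) ∧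
      K ⊆ Θ '' Metric.ball 0 r := by
  set C : Set (ContactSpace n) := (fun w : ℝ × ContactSpace n => dil n w.1 w.2) ''
    (Icc 0 1 ×ˢ (Φ.symm '' K ∪ Metric.closedBall 0 r)) with hCdef
  have hC : IsCompact C := (isCompact_Icc.prod ((hK.image hΦ.contDiff_symm.continuous).union
    (isCompact_closedBall _ _))).image (continuous_dil n)
  have hsub : Φ.symm '' K ∪ Metric.closedBall 0 r ⊆ U := by
    refine union_subset ?_ hball
    rintro _ ⟨y, hy, rfl⟩
    rw [← Equiv.Perm.apply_mem_iff_of_forall_notMem hoff, Equiv.apply_symm_apply]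
    exact hKU hy
  have hCU : C ⊆ U := by
    rintro _ ⟨⟨a, x⟩, ⟨ha, hx⟩, rfl⟩
    exact hstar a ha x (hsub hx)
  have hsubC : Φ.symm '' K ∪ Metric.closedBall 0 r ⊆ C := fun x hx =>
    ⟨(1, x), ⟨by simp, hx⟩, dil_one x⟩
  have hexp : ∀ s : ℝ, 0 ≤ s → Real.exp (-s) ≤ 1 := fun s hs => by simpa using hs
  have hCstar : ∀ s : ℝ, 0 ≤ s → ∀ x ∈ C, dil n (Real.exp (-s)) x ∈ C := by
    rintro s hs _ ⟨⟨a, x⟩, ⟨ha, hx⟩, rfl⟩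
    refine ⟨(Real.exp (-s) * a, x), ⟨⟨mul_nonneg (Real.exp_pos _).le ha.1, ?_⟩, hx⟩,
      (dil_dil _ _ _).symm⟩
    exact mul_le_one₀ (hexp s hs) ha.1 ha.2
  obtain ⟨M, hM⟩ := hC.isBounded.exists_norm_le
  obtain ⟨T, hT1, hTr⟩ : ∃ T : ℝ, 1 ≤ T ∧ Real.exp (-T) * M < r := by
    have h := Real.tendsto_exp_neg_atTop_nhds_zero.mul_const M
    rw [zero_mul] at h
    exact ((eventually_ge_atTop 1).and (h.eventually_lt_const hr)).exists
  obtain ⟨Ψ, hΨ, hΨoff, hΨon⟩ := exists_contact_eq_dil hC hU hCU hCstar (zero_le_one.trans hT1)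
  obtain ⟨Λ, hΛ, hΛoff, hΛon⟩ := exists_contact_eq_dil (V := Metric.ball 0 r)
    (C := dil n (Real.exp (-1)) '' Metric.closedBall 0 r)
    ((isCompact_closedBall _ _).image ((continuous_dil n).comp (Continuous.prodMk_right _)))
    Metric.isOpen_ball (by
      rintro _ ⟨x, hx, rfl⟩
      rw [mem_closedBall_zero_iff] at hx
      rw [mem_ball_zero_iff]
      have h1 : Real.exp (-1) < 1 := by simp
      calc _ ≤ Real.exp (-1) * ‖x‖ := norm_dil_le (Real.exp_pos _).le h1.le x
        _ ≤ Real.exp (-1) * r := by gcongr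
        _ < r := by nlinarith)
    (by
      rintro s hs _ ⟨x, hx, rfl⟩
      refine ⟨dil n (Real.exp (-s)) x, ?_, by rw [dil_dil, dil_dil, mul_comm]⟩
      rw [mem_closedBall_zero_iff] at hx ⊢
      exact (norm_dil_le (Real.exp_pos _).le (hexp s hs) x).trans
        ((mul_le_of_le_one_left (norm_nonneg _) (hexp s hs)).trans hx))
    (sub_nonneg.2 hT1)
  refine ⟨(Ψ.trans Λ.symm).symm.trans Φ, (hΨ.trans hΛ.symm).symm.trans hΦ, fun x hx => ?_,
    fun b hb => ?_, fun y hy => ?_⟩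
  · have hΛx : Λ x = x := hΛoff x fun h => hx (hball (Metric.ball_subset_closedBall h))
    have hΨx : Ψ.symm x = x := by rw [Equiv.symm_apply_eq, hΨoff x hx]
    simp [hΛx, hΨx, hoff x hx]
  · have hb' := Metric.ball_subset_closedBall hb
    have h1 := hΛon _ (mem_image_of_mem _ hb')
    rw [dil_dil, ← Real.exp_add, show -(T - 1) + -1 = -T by ring,
      ← hΨon b (hsubC (Or.inr hb'))] at h1
    simp [h1]
  · refine ⟨Λ.symm (Ψ (Φ.symm y)), ?_, by simp⟩
    have hx := hsubC (Or.inl (mem_image_of_mem _ hy))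
    rw [← Equiv.Perm.apply_mem_iff_of_forall_notMem hΛoff, Equiv.apply_symm_apply, hΨon _ hx,
      mem_ball_zero_iff]
    refine (norm_dil_le (Real.exp_pos _).le (hexp T (zero_le_one.trans hT1)) _).trans_lt ?_
    exact (mul_le_mul_of_nonneg_left (hM _ hx) (Real.exp_pos _).le).trans_lt hTr

/-- A star-shaped open set is the image of a global contact embedding. -/
theorem exists_contact_equiv {n : ℕ} {U : Set (ContactSpace n)} (hU : IsOpen U) (h0 : 0 ∈ U)
    (hstar : ∀ a ∈ Icc (0 : ℝ) 1, ∀ x ∈ U, dil n a x ∈ U) :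
    ∃ F G : ContactSpace n → ContactSpace n, ContDiffOn ℝ ∞ F U ∧ ContDiff ℝ ∞ G ∧
      (∀ p ∈ U, G (F p) = p) ∧ (∀ q, G q ∈ U ∧ F (G q) = q) ∧
      ∀ p ∈ U, ∃ c : ℝ, 0 < c ∧ ∀ v, stdForm n (F p) (fderiv ℝ F p v) = c * stdForm n p v := by
  obtain ⟨r, hr, hball⟩ := Metric.nhds_basis_closedBall.mem_iff.1 (hU.mem_nhds h0)
  obtain ⟨K, hK, hKU⟩ : IsSigmaCompact U := by
    rw [isSigmaCompact_iff_sigmaCompactSpace]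
    have := hU.locallyCompactSpace
    infer_instance
  let S := {Φ : Equiv.Perm (ContactSpace n) // IsContactMap (stdForm n) (stdForm n) Φ ∧
    ∀ x ∉ U, Φ x = x}
  have hstep : ∀ (k : ℕ) (Φ : S), ∃ Θ : S,
      (∀ b ∈ Metric.ball 0 r, Θ.1 (dil n (Real.exp (-1)) b) = Φ.1 b) ∧
      K k ⊆ Θ.1 '' Metric.ball 0 r := fun k Φ => by
    obtain ⟨Θ, h1, h2, h3, h4⟩ := exists_engulfing hU hstar hr hball (hK k)
      (hKU ▸ subset_iUnion K k) Φ.2.1 Φ.2.2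
    exact ⟨⟨Θ, h1, h2⟩, h3, h4⟩
  choose next hnext hengulf using hstep
  let seq : ℕ → S := fun k => Nat.rec ⟨Equiv.refl _, .refl _, fun _ _ => rfl⟩ next k
  have hseq : ∀ k, seq (k + 1) = next k (seq k) := fun k => rfl
  let g : ℕ → Equiv.Perm (ContactSpace n) := fun k => (dilPerm n (-k)).trans (seq k).1
  have hg : ∀ k, IsContactMap (stdForm n) (stdForm n) (g k) := fun k =>
    (isContactMap_dilPerm n _).trans (seq k).2.1
  let B : ℕ → Set (ContactSpace n) := fun k => dilPerm n (-k) ⁻¹' Metric.ball 0 r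
  have hBopen : ∀ k, IsOpen (B k) := fun k =>
    Metric.isOpen_ball.preimage (isContactMap_dilPerm n _).contDiff.continuous
  have hsucc : ∀ (k : ℕ) p, dilPerm n (-(k + 1 : ℕ)) p =
      dil n (Real.exp (-1)) (dilPerm n (-k) p) := fun k p => by
    rw [dilPerm_apply, dilPerm_apply, dil_dil, ← Real.exp_add]
    congr 2
    push_cast
    ring
  have hBmono : Monotone B := by
    refine monotone_nat_of_le_succ fun k p hp => ?_
    simp only [B, mem_preimage, hsucc, mem_ball_zero_iff] at hp ⊢
    have h1 : Real.exp (-1) ≤ 1 := by simp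
    exact (norm_dil_le (Real.exp_pos _).le h1 _).trans_lt
      ((mul_le_of_le_one_left (norm_nonneg _) h1).trans_lt hp)
  have hBcover : ∀ p, ∃ k, p ∈ B k := fun p => by
    have h := (Real.tendsto_exp_neg_atTop_nhds_zero.comp
      tendsto_natCast_atTop_atTop).mul_const ‖p‖
    rw [zero_mul] at h
    obtain ⟨k, hk⟩ := (h.eventually_lt_const hr).exists
    refine ⟨k, mem_ball_zero_iff.2 ((norm_dil_le (Real.exp_pos _).le ?_ p).trans_lt hk)⟩
    simp
  have hgle : ∀ j k, j ≤ k → ∀ p ∈ B j, g k p = g j p := fun j k hjk p hp => by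
    induction k, hjk using Nat.le_induction with
    | base => rfl
    | succ k hjk ih =>
      rw [← ih]
      change (seq (k + 1)).1 (dilPerm n (-(k + 1 : ℕ)) p) = (seq k).1 (dilPerm n (-k) p)
      rw [hsucc, hseq]
      exact hnext k (seq k) _ (hBmono hjk hp)
  choose κ hκ using hBcover
  let G : ContactSpace n → ContactSpace n := fun p => g (κ p) p
  have hG : ∀ k, ∀ p ∈ B k, G p = g k p := fun k p hp => by
    rcases le_total k (κ p) with h | h
    · exact hgle _ _ h p hp
    · exact (hgle _ _ h p (hκ p)).symm
  have hGU : ∀ p, G p ∈ U := fun p =>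
    (Equiv.Perm.apply_mem_iff_of_forall_notMem (seq (κ p)).2.2 _).2
      (hball (Metric.ball_subset_closedBall (hκ p)))
  have hGsurj : ∀ y ∈ U, ∃ k, (g k).symm y ∈ B k := fun y hy => by
    rw [← hKU] at hy
    obtain ⟨k, hk⟩ := mem_iUnion.1 hy
    obtain ⟨b, hb, hby⟩ := hengulf k (seq k) hk
    refine ⟨k + 1, ?_⟩
    have : (seq (k + 1)).1.symm y = b := by rw [Equiv.symm_apply_eq, hseq, hby]
    simpa [B, g, this] using hb
  have hGinj : Function.Injective G := fun p q hpq => by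
    have hp := hBmono (le_max_left (κ p) (κ q)) (hκ p)
    have hq := hBmono (le_max_right (κ p) (κ q)) (hκ q)
    rw [hG _ p hp, hG _ q hq] at hpq
    exact (g _).injective hpq
  let F := Function.invFun G
  have hFG : ∀ q, F (G q) = q := Function.leftInverse_invFun hGinj
  have hF : ∀ k y, (g k).symm y ∈ B k → F y = (g k).symm y := fun k y hy => by
    have := hG k _ hy
    rw [Equiv.apply_symm_apply] at this
    conv_lhs => rw [← this]
    exact hFG _
  have hFev : ∀ y ∈ U, ∃ k, F =ᶠ[𝓝 y] (g k).symm := fun y hy => by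
    obtain ⟨k, hk⟩ := hGsurj y hy
    refine ⟨k, ?_⟩
    filter_upwards [((hBopen k).preimage (hg k).contDiff_symm.continuous).mem_nhds hk]
      with z hz using hF k z hz
  refine ⟨F, G, fun y hy => ?_, contDiff_iff_contDiffAt.2 fun p => ?_, fun y hy => ?_,
    fun q => ⟨hGU q, hFG q⟩, fun y hy => ?_⟩
  · obtain ⟨k, hk⟩ := hFev y hy
    exact ((hg k).contDiff_symm.contDiffAt.congr_of_eventuallyEq hk).contDiffWithinAt
  · refine (hg (κ p)).contDiff.contDiffAt.congr_of_eventuallyEq ?_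
    filter_upwards [(hBopen (κ p)).mem_nhds (hκ p)] with q hq using hG _ q hq
  · obtain ⟨k, hk⟩ := hGsurj y hy
    rw [hF k y hk, hG k _ hk, Equiv.apply_symm_apply]
  · obtain ⟨k, hk⟩ := hFev y hy
    rw [hk.fderiv_eq, hk.self_of_nhds]
    exact (hg k).symm.exists_factor y

/-- Any open domain `U ∋ 0` in the standard contact `ℝ^{2n+1}` which is star-shaped
with respect to the contact vector field `W = 2z ∂/∂z + Σ (xᵢ ∂/∂xᵢ + yᵢ ∂/∂yᵢ)`
(i.e. invariant under the backward flow `ψ_{-s}(x,y,z) = (e^{-s}x, e^{-s}y, e^{-2s}z)`,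
`s ≥ 0`) is contactomorphic to the standard contact `ℝ^{2n+1}`: there is a smooth
diffeomorphism `F : U → ℝ^{2n+1}` and a positive smooth function `g` on `U` with
`F*α = g·α`, where `α = dz + Σ(xᵢ dyᵢ − yᵢ dxᵢ)`. -/
theorem stmt_12 (n : ℕ) (hn : 1 ≤ n)
    (α : ((Fin n → ℝ) × (Fin n → ℝ) × ℝ) → ((Fin n → ℝ) × (Fin n → ℝ) × ℝ) → ℝ)
    (hα : ∀ (x y : Fin n → ℝ) (z : ℝ) (u v : Fin n → ℝ) (w : ℝ),
      α (x, y, z) (u, v, w) = w + ∑ i, (x i * v i - y i * u i))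
    (ψ : ℝ → ((Fin n → ℝ) × (Fin n → ℝ) × ℝ) → ((Fin n → ℝ) × (Fin n → ℝ) × ℝ))
    (hψ : ∀ (s : ℝ) (x y : Fin n → ℝ) (z : ℝ),
      ψ s (x, y, z) = (fun i => Real.exp s * x i, fun i => Real.exp s * y i,
        Real.exp (2 * s) * z))
    (U : Set ((Fin n → ℝ) × (Fin n → ℝ) × ℝ)) (hUopen : IsOpen U)
    (hU0 : ((0 : Fin n → ℝ), (0 : Fin n → ℝ), (0 : ℝ)) ∈ U)
    (hstar : ∀ s : ℝ, 0 ≤ s → ∀ p ∈ U, ψ (-s) p ∈ U) :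
    ∃ (F G : ((Fin n → ℝ) × (Fin n → ℝ) × ℝ) → ((Fin n → ℝ) × (Fin n → ℝ) × ℝ))
      (g : ((Fin n → ℝ) × (Fin n → ℝ) × ℝ) → ℝ),
      ContDiffOn ℝ (⊤ : ℕ∞) F U ∧ ContDiff ℝ (⊤ : ℕ∞) G ∧
      (∀ p ∈ U, G (F p) = p) ∧
      (∀ q : (Fin n → ℝ) × (Fin n → ℝ) × ℝ, G q ∈ U ∧ F (G q) = q) ∧
      ContDiffOn ℝ (⊤ : ℕ∞) g U ∧ (∀ p ∈ U, 0 < g p) ∧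
      (∀ p ∈ U, ∀ v : (Fin n → ℝ) × (Fin n → ℝ) × ℝ,
        α (F p) (fderiv ℝ F p v) = g p * α p v) := by
  have hα' : α = stdForm n := funext fun p => funext fun v => hα _ _ _ _ _ _
  subst hα'
  have hψ' : ∀ s p, ψ s p = dil n (Real.exp s) p := fun s p => by
    rw [show p = (p.1, p.2.1, p.2.2) from rfl, hψ, mul_comm 2 s, Real.exp_mul]
    simp only [dil, Real.rpow_ofNat]
    rfl
  have hdil : ∀ a ∈ Icc (0 : ℝ) 1, ∀ x ∈ U, dil n a x ∈ U := by
    rintro a ⟨ha, ha1⟩ x hx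
    rcases ha.eq_or_lt with rfl | ha
    · convert hU0 using 1
      simp [dil]
    · have := hstar (-Real.log a) (by linarith [Real.log_nonpos ha.le ha1]) x hx
      rwa [neg_neg, hψ', Real.exp_log ha] at this
  obtain ⟨F, G, hF, hG, hGF, hFG, hc⟩ := exists_contact_equiv hUopen hU0 hdil
  have hone : ∀ p, stdForm n p (0, 0, 1) = 1 := fun p => by simp [stdForm]
  have hfactor : ∀ p ∈ U, 0 < stdForm n (F p) (fderiv ℝ F p (0, 0, 1)) ∧
      ∀ v, stdForm n (F p) (fderiv ℝ F p v) =
        stdForm n (F p) (fderiv ℝ F p (0, 0, 1)) * stdForm n p v := fun p hp => by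
    obtain ⟨c, hc0, hcv⟩ := hc p hp
    have h1 := hcv (0, 0, 1)
    rw [hone, mul_one] at h1
    rw [h1]
    exact ⟨hc0, hcv⟩
  refine ⟨F, G, fun p => stdForm n (F p) (fderiv ℝ F p (0, 0, 1)), hF, hG, hGF, hFG, ?_,
    fun p hp => (hfactor p hp).1, fun p hp => (hfactor p hp).2⟩
  have hD : ContDiffOn ℝ ∞ (fun p => fderiv ℝ F p (0, 0, 1)) U :=
    (hF.fderiv_of_isOpen hUopen (by simp)).clm_apply contDiffOn_const
  have hform : ContDiff ℝ ∞ fun w : ContactSpace n × ContactSpace n => stdForm n w.1 w.2 :=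
    ContDiff.add (by fun_prop) (ContDiff.sum fun i _ => by fun_prop)
  exact hform.comp_contDiffOn (hF.prodMk hD)
end
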